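/- There is a wait-free, linearizable implementation of an n-process auditable load-linked/store-conditional (LL/SC) object from 2n-sliding registers and standard read/write registers, with O(n) step complexity per LL, SC, and AUDIT operation. -/

import Mathlib

/-!
# A generic model of wait-free implementations from shared base objects

Processes communicate through atomic *base objects* (given as sequential
state machines).  An implementation assigns to each process and each
high-level operation a deterministic program which, given the sequence of
primitive responses received so far in the current operation, either applies
the next primitive to some base object or returns a high-level response.
Executions are sequences of events (invocations, primitive steps, responses)
driven by an arbitrary scheduler.  Linearizability is defined with respect to
a deterministic sequential specification, and wait-freedom/step complexity by
bounding the number of steps a process takes within any of its operations.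
-/

namespace Shared

/-- A type of atomic base object: a sequential state machine. -/
structure ObjType where
  St : Type
  Op : Type
  Res : Type
  init : St
  δ : St → Op → St × Res

universe u

variable {P HOp HRes : Type} {I : Type} {mem : I → ObjType}

/-- A deterministic program for one high-level operation: given the list of
primitive responses received so far, either the next primitive to apply
(object index and primitive operation), or the high-level response. -/
def Prog (I : Type) (mem : I → ObjType) (HRes : Type) : Type :=
  List (Σ i : I, (mem i).Res) → (Σ i : I, (mem i).Op) ⊕ HRes

/-- An implementation of a high-level object with operations `HOp` and
responses `HRes`, for processes `P`, from base objects `mem`. -/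
structure Impl (P HOp HRes : Type) (I : Type) (mem : I → ObjType) where
  prog : P → HOp → Prog I mem HRes

/-- A configuration: the state of every base object, and for each process the
pending high-level operation together with the log of primitive responses it
has received so far (`none` if the process is idle). -/
structure Cfg (P HOp : Type) (I : Type) (mem : I → ObjType) where
  mst : ∀ i : I, (mem i).St
  pst : P → Option (HOp × List (Σ i : I, (mem i).Res))

/-- Events: invocation of a high-level operation, a primitive step by a
process, or the response of a high-level operation. -/
inductive Ev (P HOp HRes : Type) where
  | inv (p : P) (op : HOp)
  | step (p : P)
  | ret (p : P) (r : HRes)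

def Ev.isStepOf [DecidableEq P] : Ev P HOp HRes → P → Bool
  | .step q, p => decide (q = p)
  | _, _ => false

def initCfg (P HOp : Type) (I : Type) (mem : I → ObjType) : Cfg P HOp I mem :=
  ⟨fun i => (mem i).init, fun _ => none⟩

/-- The transition relation of the system. -/
def EStep [DecidableEq P] [DecidableEq I] (impl : Impl P HOp HRes I mem)
    (c : Cfg P HOp I mem) (e : Ev P HOp HRes) (c' : Cfg P HOp I mem) : Prop :=
  match e with
  | .inv p op =>
      c.pst p = none ∧
      c' = { c with pst := Function.update c.pst p (some (op, [])) }
  | .step p =>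
      ∃ op log i o, c.pst p = some (op, log) ∧
        impl.prog p op log = Sum.inl ⟨i, o⟩ ∧
        c' = ⟨Function.update c.mst i ((mem i).δ (c.mst i) o).1,
              Function.update c.pst p
                (some (op, log ++ [⟨i, ((mem i).δ (c.mst i) o).2⟩]))⟩
  | .ret p r =>
      ∃ op log, c.pst p = some (op, log) ∧
        impl.prog p op log = Sum.inr r ∧
        c' = { c with pst := Function.update c.pst p none }

/-- A finite execution of an implementation. -/
structure Run [DecidableEq P] [DecidableEq I] (impl : Impl P HOp HRes I mem) where
  len : ℕ
  cfg : ℕ → Cfg P HOp I mem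
  ev : ℕ → Ev P HOp HRes
  h0 : cfg 0 = initCfg P HOp I mem
  hstep : ∀ t, t < len → EStep impl (cfg t) (ev t) (cfg (t + 1))

variable [DecidableEq P] [DecidableEq I]

def InvAt {impl : Impl P HOp HRes I mem} (R : Run impl)
    (t : ℕ) (p : P) (o : HOp) : Prop :=
  t < R.len ∧ R.ev t = .inv p o

def RetAt {impl : Impl P HOp HRes I mem} (R : Run impl)
    (t : ℕ) (p : P) (r : HRes) : Prop :=
  t < R.len ∧ R.ev t = .ret p r

/-- `tret` is the matching response of the operation of `p` invoked at `tinv`. -/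
def MatchedRet {impl : Impl P HOp HRes I mem} (R : Run impl)
    (tinv tret : ℕ) (p : P) (r : HRes) : Prop :=
  tinv < tret ∧ RetAt R tret p r ∧
    ∀ u r', tinv < u → u < tret → ¬ RetAt R u p r'

/-- A deterministic sequential specification of a high-level object. -/
structure SeqSpec (P HOp HRes : Type) where
  St : Type
  init : St
  δ : St → P → HOp → St × HRes

/-- The sequential history `L` is legal for the specification, from state `s`. -/
def SeqConsistent (spec : SeqSpec P HOp HRes) :
    spec.St → List (P × HOp × HRes) → Prop
  | _, [] => True
  | s, (p, o, r) :: rest =>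
      (spec.δ s p o).2 = r ∧ SeqConsistent spec (spec.δ s p o).1 rest

/-- Linearizability of a run: there is a legal sequential history `L`
containing every completed operation of the run (with its actual response)
and possibly some pending ones (completed with arbitrary responses), which
preserves the real-time precedence between operations. -/
def IsLin (spec : SeqSpec P HOp HRes) {impl : Impl P HOp HRes I mem}
    (R : Run impl) : Prop :=
  ∃ (L : List (P × HOp × HRes)) (φ : Fin L.length → ℕ),
    SeqConsistent spec spec.init L ∧
    Function.Injective φ ∧
    -- `φ k` is the invocation of the `k`-th operation of `L`
    (∀ k, InvAt R (φ k) (L.get k).1 (L.get k).2.1) ∧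
    -- every completed operation appears in `L`, with its actual response
    (∀ t p o tr r, InvAt R t p o → MatchedRet R t tr p r →
        ∃ k, φ k = t ∧ L.get k = (p, o, r)) ∧
    (∀ k tr r, MatchedRet R (φ k) tr (L.get k).1 r → (L.get k).2.2 = r) ∧
    -- real-time precedence is preserved
    (∀ k k' tr r, MatchedRet R (φ k) tr (L.get k).1 r → tr < φ k' → k < k')

/-- All invocations in the run respect the role/legality constraint. -/
def LegalRun {impl : Impl P HOp HRes I mem} (R : Run impl)
    (legal : P → HOp → Prop) : Prop :=
  ∀ t p o, InvAt R t p o → legal p o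

/-- A process takes at most `C` of its own primitive steps between the
invocation of any of its operations and its (possibly missing) response:
bounded wait-freedom / step complexity `C` per operation. -/
def StepBound {impl : Impl P HOp HRes I mem}
    (R : Run impl) (C : ℕ) : Prop :=
  ∀ t p o, InvAt R t p o →
    ∀ b, b ≤ R.len → (∀ u r, t < u → u < b → ¬ RetAt R u p r) →
      ((Finset.Ioo t b).filter fun u => (R.ev u).isStepOf p).card ≤ C

/-- The implementation only ever issues primitive operations allowed by
`ok` (used to express port/ownership restrictions on base objects). -/
def IssuesOnly (impl : Impl P HOp HRes I mem)
    (ok : ∀ (p : P) (i : I), (mem i).Op → Prop) : Prop :=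
  ∀ R : Run impl, ∀ t p, t < R.len → R.ev t = .step p →
    ∀ op log i o, (R.cfg t).pst p = some (op, log) →
      impl.prog p op log = Sum.inl ⟨i, o⟩ → ok p i o

/-! ### Base object types -/

/-- Primitive operations of a (sliding or plain) read/write register. -/
inductive RegOp (V : Type) where
  | write (v : V)
  | read

/-- A `k`-sliding register over values `V`: stores the sequence of the last
`k` values written to it; a write appends the new value (discarding the
oldest if the sequence already has length `k`), a read returns the current
sequence. -/
def SlidingReg (k : ℕ) (V : Type) : ObjType where
  St := List V
  Op := RegOp V
  Res := List V
  init := []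
  δ := fun s o =>
    match o with
    | .write v => ((s ++ [v]).drop (s.length + 1 - k), [])
    | .read => (s, s)

/-- A standard atomic read/write register over `V` with initial value `v0`. -/
def RWReg (V : Type) (v0 : V) : ObjType where
  St := V
  Op := RegOp V
  Res := Option V
  init := v0
  δ := fun s o =>
    match o with
    | .write v => (v, none)
    | .read => (s, some s)

end Shared

namespace Shared

/-!
## STATEMENT 18: an `n`-process auditable LL/SC object from `2n`-sliding
registers and standard read/write registers, with `O(n)` step complexity
per LL, SC and AUDIT operation.
-/

/-- Operations of the auditable LL/SC object. -/
inductive LOp where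
  | ll
  | sc (v : ℕ)
  | audit

/-- Responses of the auditable LL/SC object: the value returned by `LL`, the
Boolean returned by `SC`, or the set of (process, value) pairs returned by
`AUDIT`. -/
inductive LRes (n : ℕ) where
  | val (v : ℕ)
  | bool (b : Bool)
  | aset (A : Finset (Fin n × ℕ))

/-- The processes: the `n` LL/SC processes and `a` auditors. -/
abbrev LProc (n a : ℕ) := Fin n ⊕ Fin a

/-- Sequential specification of the `n`-process auditable LL/SC object with
initial value `v0`.  The state is the current value, the set of processes
whose link is valid (they performed an `LL` and nobody wrote since), and the
set of (process, value) pairs of the `LL`s performed so far.  `LL` by `p`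
returns the current value `v`, validates `p`'s link and records `(p, v)`;
`SC(new)` by `p` succeeds (writes `new`, invalidates all links, returns
`true`) iff `p`'s link is valid, i.e. iff nobody wrote since `p`'s last
`LL`; `AUDIT` returns exactly the pairs of the preceding `LL`s. -/
def llscSpec (n a : ℕ) (v0 : ℕ) : SeqSpec (LProc n a) LOp (LRes n) where
  St := ℕ × Finset (Fin n) × Finset (Fin n × ℕ)
  init := (v0, ∅, ∅)
  δ := fun s p o =>
    match p, o with
    | .inl i, .ll => ((s.1, insert i s.2.1, insert (i, s.1) s.2.2), .val s.1)
    | .inl i, .sc v =>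
        if i ∈ s.2.1 then ((v, ∅, s.2.2), .bool true) else (s, .bool false)
    | _, .audit => (s, .aset s.2.2)
    | _, _ => (s, .bool false)

/-- Role restrictions: `LL` and `SC` are performed by the `n` processes,
`AUDIT` by all processes. -/
def LLegal (n a : ℕ) : LProc n a → LOp → Prop
  | .inl _, .ll => True
  | .inl _, .sc _ => True
  | _, .audit => True
  | _, _ => False


end Shared

namespace Shared

/-! ### The algorithm -/

/-- A log entry: process, sequence number, operation. -/
abbrev Entry (n : ℕ) := Fin n × ℕ × LOp

/-- A history: a list of batches of entries. -/
abbrev Hist (n : ℕ) := List (List (Entry n))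

/-- Contents of the single-writer register of a process. -/
structure Rec (n : ℕ) where
  s : ℕ
  o : LOp
  h : Hist n

def Rec.z (n : ℕ) : Rec n := ⟨0, .ll, []⟩

abbrev LMem (n : ℕ) : ℕ ⊕ Fin n → ObjType :=
  Sum.elim (fun _ : ℕ => SlidingReg (2 * n) (Fin n × Hist n))
    (fun _ : Fin n => RWReg (Rec n) (Rec.z n))

/-- Local states of the program of an operation. -/
inductive LS (n : ℕ) where
  | bad
  | q (j : Fin n) (h : Hist n)
  | qf (h : Hist n)
  | a0
  | a1 (s : ℕ) (h : Hist n)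
  | c1 (r : Bool) (s : ℕ) (j : Fin n) (h : Hist n)
  | c2 (r : Bool) (s : ℕ) (j : Fin n) (h : Hist n) (b : List (Entry n))
  | w (r : Bool) (s : ℕ) (h : Hist n)
  | d (r : Bool) (s : ℕ) (k : ℕ)
  | hw (r : Bool) (s : ℕ) (h : Hist n)
  | fin (s : ℕ) (h : Hist n)

/-- one step of the sequential specification on an entry -/
def eStep (n a v0 : ℕ) (st : (llscSpec n a v0).St) (e : Entry n) :
    (llscSpec n a v0).St × LRes n :=
  (llscSpec n a v0).δ st (.inl e.1) e.2.2

def runE (n a v0 : ℕ) (st : (llscSpec n a v0).St) (l : List (Entry n)) : (llscSpec n a v0).St :=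
  l.foldl (fun st e => (eStep n a v0 st e).1) st

open Classical in
/-- the response of entry `e` in the list `l` run from state `st` -/
noncomputable def resAt (n a v0 : ℕ) : (llscSpec n a v0).St → List (Entry n) → Entry n → LRes n
  | _, [], _ => .bool false
  | st, x :: xs, e =>
    if x = e then (eStep n a v0 st x).2 else resAt n a v0 (eStep n a v0 st x).1 xs e

def pick {n : ℕ} (h g : Hist n) : Hist n := if h.length < g.length then g else h

open Classical in
noncomputable def addE {n : ℕ} (h : Hist n) (b : List (Entry n)) (e : Entry n) : List (Entry n) :=
  if e.2.1 = 0 ∨ e ∈ h.flatten ∨ e ∈ b then b else b ++ [e]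

def getRec {n : ℕ} : (Σ i : ℕ ⊕ Fin n, (LMem n i).Res) → Rec n
  | ⟨.inl _, _⟩ => Rec.z n
  | ⟨.inr _, x⟩ => Option.getD (α := Rec n) x (Rec.z n)

def getL {n : ℕ} : (Σ i : ℕ ⊕ Fin n, (LMem n i).Res) → List (Fin n × Hist n)
  | ⟨.inl _, l⟩ => l
  | ⟨.inr _, _⟩ => []

def firstH {n : ℕ} (l : List (Fin n × Hist n)) : Hist n := (l.map Prod.snd).headD []

def initLS (n a : ℕ) [NeZero n] : LProc n a → LOp → LS n
  | _, .audit => .q 0 []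
  | .inl _, _ => .a0
  | .inr _, _ => .bad

def rdOp (n : ℕ) (j : Fin n) : Σ i : ℕ ⊕ Fin n, (LMem n i).Op :=
  ⟨.inr j, (RegOp.read : RegOp (Rec n))⟩

def wrOp (n : ℕ) (j : Fin n) (r : Rec n) : Σ i : ℕ ⊕ Fin n, (LMem n i).Op :=
  ⟨.inr j, (RegOp.write r : RegOp (Rec n))⟩

def rdC (n : ℕ) (k : ℕ) : Σ i : ℕ ⊕ Fin n, (LMem n i).Op :=
  ⟨.inl k, (RegOp.read : RegOp (Fin n × Hist n))⟩

def wrC (n : ℕ) (k : ℕ) (v : Fin n × Hist n) : Σ i : ℕ ⊕ Fin n, (LMem n i).Op :=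
  ⟨.inl k, (RegOp.write v : RegOp (Fin n × Hist n))⟩

/-- next primitive or response -/
noncomputable def nextLS (n a v0 : ℕ) :
    LProc n a → LOp → LS n → (Σ i : ℕ ⊕ Fin n, (LMem n i).Op) ⊕ LRes n
  | _, _, .q j _ => .inl (rdOp n j)
  | _, _, .qf h => .inr (.aset (runE n a v0 (llscSpec n a v0).init h.flatten).2.2)
  | .inl p, _, .a0 => .inl (rdOp n p)
  | .inl p, op, .a1 s h => .inl (wrOp n p ⟨s + 1, op, h⟩)
  | .inl _, _, .c1 _ _ j _ => .inl (rdOp n j)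
  | .inl _, _, .c2 _ _ j _ _ => .inl (rdOp n j)
  | .inl p, _, .w _ _ h => .inl (wrC n h.length (p, h))
  | .inl _, _, .d _ _ k => .inl (rdC n k)
  | .inl p, op, .hw _ s h => .inl (wrOp n p ⟨s, op, h⟩)
  | .inl p, op, .fin s h => .inr (resAt n a v0 (llscSpec n a v0).init h.flatten (p, s, op))
  | _, _, _ => .inr (.bool false)

/-- update of the local state by a response -/
noncomputable def updLS (n : ℕ) [NeZero n] (ls : LS n)
    (x : Σ i : ℕ ⊕ Fin n, (LMem n i).Res) : LS n :=
  match ls with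
  | .q j h => if hj : j.val + 1 < n then .q ⟨j.val + 1, hj⟩ (pick h (getRec x).h)
      else .qf (pick h (getRec x).h)
  | .a0 => .a1 (getRec x).s (getRec x).h
  | .a1 s _ => .c1 true (s + 1) 0 []
  | .c1 r s j h => if hj : j.val + 1 < n then .c1 r s ⟨j.val + 1, hj⟩ (pick h (getRec x).h)
      else .c2 r s 0 (pick h (getRec x).h) []
  | .c2 r s j h b =>
      if hj : j.val + 1 < n then
        .c2 r s ⟨j.val + 1, hj⟩ h (addE h b (j, (getRec x).s, (getRec x).o))
      else .w r s (h ++ [addE h b (j, (getRec x).s, (getRec x).o)])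
  | .w r s h => .d r s h.length
  | .d r s _ => .hw r s (firstH (getL x))
  | .hw true s _ => .c1 false s 0 []
  | .hw false s h => .fin s h
  | ls => ls

noncomputable def foldLS (n a : ℕ) [NeZero n] (p : LProc n a) (op : LOp)
    (log : List (Σ i : ℕ ⊕ Fin n, (LMem n i).Res)) : LS n :=
  log.foldl (updLS n) (initLS n a p op)

noncomputable def theImpl (n a v0 : ℕ) [NeZero n] :
    Impl (LProc n a) LOp (LRes n) (ℕ ⊕ Fin n) (LMem n) where
  prog := fun p op log => nextLS n a v0 p op (foldLS n a p op log)

/-! ### Step bound -/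

def rank {n : ℕ} : LS n → ℕ
  | .bad => 0
  | .q j _ => n - j.val
  | .qf _ => 0
  | .a0 => 2 + 2 * (2 * n + 3)
  | .a1 _ _ => 1 + 2 * (2 * n + 3)
  | .c1 r _ j _ => 3 + n + (n - j.val) + r.toNat * (2 * n + 3)
  | .c2 r _ j _ _ => 3 + (n - j.val) + r.toNat * (2 * n + 3)
  | .w r _ _ => 3 + r.toNat * (2 * n + 3)
  | .d r _ _ => 2 + r.toNat * (2 * n + 3)
  | .hw r _ _ => 1 + r.toNat * (2 * n + 3)
  | .fin _ _ => 0

theorem rank_upd (n a v0 : ℕ) [NeZero n] (p : LProc n a) (op : LOp) (ls : LS n) (i o x)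
    (h : nextLS n a v0 p op ls = .inl ⟨i, o⟩) : rank (updLS n ls x) + 1 ≤ rank ls := by
  have hn : 0 < n := Nat.pos_of_ne_zero (NeZero.ne n)
  cases ls <;> rcases p with p | p <;> simp [nextLS] at h <;> simp only [updLS]
  case q.inl j g => have := j.2; split_ifs <;> simp [rank] <;> omega
  case q.inr j g => have := j.2; split_ifs <;> simp [rank] <;> omega
  case c1.inl r s j h => have := j.2; split_ifs <;> simp [rank] <;> omega
  case c2.inl r s j h b => have := j.2; split_ifs <;> simp [rank] <;> omega
  case hw.inl r s h => cases r <;> simp [rank] <;> omega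
  all_goals simp [rank] <;> omega

theorem rank_init (n a : ℕ) [NeZero n] (p : LProc n a) (op : LOp) :
    rank (initLS n a p op) ≤ 12 * n := by
  have hn : 0 < n := Nat.pos_of_ne_zero (NeZero.ne n)
  rcases p with p | p <;> cases op <;> simp [initLS, rank] <;> omega

theorem stepBound_main (n a v0 : ℕ) [NeZero n] (R : Run (theImpl n a v0)) :
    StepBound R (12 * n) := by
  intro t p o ht b hb hret
  have key : ∀ u, t < u → u ≤ b → ∃ log, (R.cfg u).pst p = some (o, log) ∧
      log.length = ((Finset.Ioo t u).filter fun u => (R.ev u).isStepOf p).card ∧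
      rank (foldLS n a p o log) + log.length ≤ rank (initLS n a p o) := by
    intro u
    induction u with
    | zero => intro h; omega
    | succ u ih =>
      intro htu hub
      have hst := R.hstep u (by omega)
      rcases Nat.lt_succ_iff_lt_or_eq.mp htu with h | h
      · obtain ⟨log, h1, h2, h3⟩ := ih h (by omega)
        have hI : Finset.Ioo t (u+1) = insert u (Finset.Ioo t u) := by
          ext v; simp; omega
        have hnr := fun r => hret u r h (by omega)
        rw [hI, Finset.filter_insert]
        cases he : R.ev u with
        | inv q op =>
          rw [he] at hst
          obtain ⟨hq, hc⟩ := hst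
          have hne : p ≠ q := by rintro rfl; simp [h1] at hq
          refine ⟨log, ?_, ?_, h3⟩
          · rw [hc]; simp [Function.update_of_ne hne, h1]
          · simpa [Ev.isStepOf] using h2
        | ret q r =>
          rw [he] at hst
          obtain ⟨op, lg, hq, hp, hc⟩ := hst
          have hne : p ≠ q := by
            rintro rfl
            exact hnr r ⟨by omega, he⟩
          refine ⟨log, ?_, ?_, h3⟩
          · rw [hc]; simp [Function.update_of_ne hne, h1]
          · simpa [Ev.isStepOf] using h2
        | step q =>
          rw [he] at hst
          obtain ⟨op, lg, i, oo, hq, hp, hc⟩ := hst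
          by_cases hne : p = q
          · subst hne
            rw [h1] at hq
            simp only [Option.some.injEq, Prod.mk.injEq] at hq
            obtain ⟨rfl, rfl⟩ := hq
            refine ⟨log ++ [⟨i, ((LMem n i).δ ((R.cfg u).mst i) oo).2⟩], ?_, ?_, ?_⟩
            · rw [hc]; simp only [Function.update_self]
            · rw [if_pos (by simp [Ev.isStepOf]), Finset.card_insert_of_notMem (by simp), ← h2]
              simp
            · have := rank_upd n a v0 p o _ i oo ⟨i, ((LMem n i).δ ((R.cfg u).mst i) oo).2⟩ hp
              simp only [foldLS, List.foldl_append, List.foldl_cons, List.foldl_nil,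
                List.length_append, List.length_singleton] at this ⊢ h3
              omega
          · refine ⟨log, ?_, ?_, h3⟩
            · rw [hc]; simp [Function.update_of_ne hne, h1]
            · simpa [Ev.isStepOf, Ne.symm hne] using h2
      · subst h
        rw [ht.2] at hst
        obtain ⟨_, hc⟩ := hst
        refine ⟨[], ?_, ?_, ?_⟩
        · rw [hc]; simp
        · have : Finset.Ioo t (t+1) = ∅ := by ext v; simp
          simp [this]
        · simp [foldLS]
  by_cases hlt : t < b
  · obtain ⟨log, _, h2, h3⟩ := key b hlt le_rfl
    have := rank_init n a p o
    omega
  · simp [Finset.Ioo_eq_empty hlt]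

end Shared

namespace Shared

/-! ### Abstract transition system -/

structure ASt (n a : ℕ) where
  reg : Fin n → Rec n
  cons : ℕ → List (Fin n × Hist n)
  loc : LProc n a → Option (LOp × LS n)

/-- local read steps -/
inductive RdStep {n a : ℕ} [NeZero n] (x : ASt n a) : LProc n a → LOp → LS n → LS n → Prop
  | qn (p op) (j : Fin n) (h) (hj : j.val + 1 < n) :
      RdStep x p op (.q j h) (.q ⟨j.val + 1, hj⟩ (pick h (x.reg j).h))
  | ql (p op) (j : Fin n) (h) (hj : ¬ j.val + 1 < n) :
      RdStep x p op (.q j h) (.qf (pick h (x.reg j).h))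
  | a0 (p op) : RdStep x (.inl p) op .a0 (.a1 (x.reg p).s (x.reg p).h)
  | c1n (p op r s) (j : Fin n) (h) (hj : j.val + 1 < n) :
      RdStep x (.inl p) op (.c1 r s j h) (.c1 r s ⟨j.val + 1, hj⟩ (pick h (x.reg j).h))
  | c1l (p op r s) (j : Fin n) (h) (hj : ¬ j.val + 1 < n) :
      RdStep x (.inl p) op (.c1 r s j h) (.c2 r s 0 (pick h (x.reg j).h) [])
  | c2n (p op r s) (j : Fin n) (h b) (hj : j.val + 1 < n) :
      RdStep x (.inl p) op (.c2 r s j h b)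
        (.c2 r s ⟨j.val + 1, hj⟩ h (addE h b (j, (x.reg j).s, (x.reg j).o)))
  | c2l (p op r s) (j : Fin n) (h b) (hj : ¬ j.val + 1 < n) :
      RdStep x (.inl p) op (.c2 r s j h b)
        (.w r s (h ++ [addE h b (j, (x.reg j).s, (x.reg j).o)]))
  | d (p op r s k) : RdStep x (.inl p) op (.d r s k) (.hw r s (firstH (x.cons k)))

def afterHw {n : ℕ} [NeZero n] : Bool → ℕ → Hist n → LS n
  | true, s, _ => .c1 false s 0 []
  | false, s, h => .fin s h

inductive AStep {n a : ℕ} [NeZero n] (v0 : ℕ) (x : ASt n a) :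
    Ev (LProc n a) LOp (LRes n) → ASt n a → Prop
  | inv (p op) : x.loc p = none →
      AStep v0 x (.inv p op) ⟨x.reg, x.cons, Function.update x.loc p (some (op, initLS n a p op))⟩
  | ret (p op ls r) : x.loc p = some (op, ls) → nextLS n a v0 p op ls = .inr r →
      AStep v0 x (.ret p r) ⟨x.reg, x.cons, Function.update x.loc p none⟩
  | rd (p op ls ls') : x.loc p = some (op, ls) → RdStep x p op ls ls' →
      AStep v0 x (.step p) ⟨x.reg, x.cons, Function.update x.loc p (some (op, ls'))⟩
  | a1 (p op s h) : x.loc (.inl p) = some (op, .a1 s h) →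
      AStep v0 x (.step (.inl p)) ⟨Function.update x.reg p ⟨s + 1, op, h⟩, x.cons,
        Function.update x.loc (.inl p) (some (op, .c1 true (s + 1) 0 []))⟩
  | hw (p op r s h) : x.loc (.inl p) = some (op, .hw r s h) →
      AStep v0 x (.step (.inl p)) ⟨Function.update x.reg p ⟨s, op, h⟩, x.cons,
        Function.update x.loc (.inl p) (some (op, afterHw r s h))⟩
  | w (p op r s) (h : Hist n) : x.loc (.inl p) = some (op, .w r s h) →
      AStep v0 x (.step (.inl p)) ⟨x.reg,
        Function.update x.cons h.length ((x.cons h.length ++ [(p, h)]).drop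
          ((x.cons h.length).length + 1 - 2 * n)),
        Function.update x.loc (.inl p) (some (op, .d r s h.length))⟩

noncomputable def absC {n a : ℕ} [NeZero n] (c : Cfg (LProc n a) LOp (ℕ ⊕ Fin n) (LMem n)) :
    ASt n a where
  reg := fun p => c.mst (.inr p)
  cons := fun k => c.mst (.inl k)
  loc := fun p => (c.pst p).map fun z => (z.1, foldLS n a p z.1 z.2)

theorem foldLS_snoc {n a : ℕ} [NeZero n] (p : LProc n a) (op : LOp) (log x) :
    foldLS n a p op (log ++ [x]) = updLS n (foldLS n a p op log) x := by
  simp [foldLS]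

theorem loc_update {n a : ℕ} [NeZero n] (f : LProc n a → Option (LOp × List (Σ i, (LMem n i).Res)))
    (p : LProc n a) (v : Option (LOp × List (Σ i, (LMem n i).Res))) :
    (fun q => (Function.update f p v q).map fun z => (z.1, foldLS n a q z.1 z.2))
     = Function.update (fun q => (f q).map fun z => (z.1, foldLS n a q z.1 z.2)) p
        (v.map fun z => (z.1, foldLS n a p z.1 z.2)) := by
  funext q
  by_cases h : q = p
  · subst h; simp
  · simp [Function.update_of_ne h]

theorem ASt.ext' {n a : ℕ} {x y : ASt n a} (h1 : x.reg = y.reg) (h2 : x.cons = y.cons)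
    (h3 : x.loc = y.loc) : x = y := by
  cases x; cases y; simp_all

theorem absC_rdReg {n a : ℕ} [NeZero n] (c c' : Cfg (LProc n a) LOp (ℕ ⊕ Fin n) (LMem n))
    (p : LProc n a) (op log) (j : Fin n)
    (hc : c' = ⟨Function.update c.mst (.inr j) ((LMem n (.inr j)).δ (c.mst (.inr j)) (RegOp.read : RegOp (Rec n))).1,
      Function.update c.pst p
                (some (op, log ++ [⟨.inr j, ((LMem n (.inr j)).δ (c.mst (.inr j)) (RegOp.read : RegOp (Rec n))).2⟩]))⟩) :
    absC c' = ⟨(absC c).reg, (absC c).cons, Function.update (absC c).loc p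
      (some (op, updLS n (foldLS n a p op log) ⟨.inr j, some ((absC c).reg j)⟩))⟩ := by
  subst hc
  apply ASt.ext'
  · funext q
    simp only [absC]
    by_cases h : q = j
    · subst h; exact Function.update_self _ _ _
    · rw [Function.update_of_ne (by simpa using h)]
  · funext q
    simp only [absC]
    rw [Function.update_of_ne (by simp)]
  · simp only [absC]
    rw [loc_update]
    simp only [Option.map_some, foldLS_snoc]
    rfl

theorem absC_rdCons {n a : ℕ} [NeZero n] (c c' : Cfg (LProc n a) LOp (ℕ ⊕ Fin n) (LMem n))
    (p : LProc n a) (op log) (k : ℕ)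
    (hc : c' = ⟨Function.update c.mst (.inl k) ((LMem n (.inl k)).δ (c.mst (.inl k)) (RegOp.read : RegOp (Fin n × Hist n))).1,
      Function.update c.pst p
                (some (op, log ++ [⟨.inl k, ((LMem n (.inl k)).δ (c.mst (.inl k)) (RegOp.read : RegOp (Fin n × Hist n))).2⟩]))⟩) :
    absC c' = ⟨(absC c).reg, (absC c).cons, Function.update (absC c).loc p
      (some (op, updLS n (foldLS n a p op log) ⟨.inl k, (absC c).cons k⟩))⟩ := by
  subst hc
  apply ASt.ext'
  · funext q
    simp only [absC]
    rw [Function.update_of_ne (by simp)]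
  · funext q
    simp only [absC]
    by_cases h : q = k
    · subst h; exact Function.update_self _ _ _
    · rw [Function.update_of_ne (by simpa using h)]
  · simp only [absC]
    rw [loc_update]
    simp only [Option.map_some, foldLS_snoc]
    rfl

theorem absC_wrReg {n a : ℕ} [NeZero n] (c c' : Cfg (LProc n a) LOp (ℕ ⊕ Fin n) (LMem n))
    (p : LProc n a) (op log) (j : Fin n) (v : Rec n)
    (hc : c' = ⟨Function.update c.mst (.inr j) ((LMem n (.inr j)).δ (c.mst (.inr j)) (RegOp.write v : RegOp (Rec n))).1,
      Function.update c.pst p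
                (some (op, log ++ [⟨.inr j, ((LMem n (.inr j)).δ (c.mst (.inr j)) (RegOp.write v : RegOp (Rec n))).2⟩]))⟩) :
    absC c' = ⟨Function.update (absC c).reg j v, (absC c).cons, Function.update (absC c).loc p
      (some (op, updLS n (foldLS n a p op log) ⟨.inr j, (none : Option (Rec n))⟩))⟩ := by
  subst hc
  apply ASt.ext'
  · funext q
    simp only [absC]
    by_cases h : q = j
    · subst h
      have e2 := Function.update_self q v (absC c).reg
      exact (Function.update_self _ _ c.mst).trans e2.symm
    · have e2 := Function.update_of_ne h v (absC c).reg
      exact (Function.update_of_ne (by simpa using h) _ c.mst).trans e2.symm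
  · funext q
    simp only [absC]
    rw [Function.update_of_ne (by simp)]
  · simp only [absC]
    rw [loc_update]
    simp only [Option.map_some, foldLS_snoc]
    rfl

theorem absC_wrCons {n a : ℕ} [NeZero n] (c c' : Cfg (LProc n a) LOp (ℕ ⊕ Fin n) (LMem n))
    (p : LProc n a) (op log) (k : ℕ) (v : Fin n × Hist n)
    (hc : c' = ⟨Function.update c.mst (.inl k) ((LMem n (.inl k)).δ (c.mst (.inl k)) (RegOp.write v : RegOp (Fin n × Hist n))).1,
      Function.update c.pst p
                (some (op, log ++ [⟨.inl k, ((LMem n (.inl k)).δ (c.mst (.inl k)) (RegOp.write v : RegOp (Fin n × Hist n))).2⟩]))⟩) :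
    absC c' = ⟨(absC c).reg, Function.update (absC c).cons k (((absC c).cons k ++ [v]).drop
          (((absC c).cons k).length + 1 - 2 * n)), Function.update (absC c).loc p
      (some (op, updLS n (foldLS n a p op log) ⟨.inl k, ([] : List (Fin n × Hist n))⟩))⟩ := by
  subst hc
  apply ASt.ext'
  · funext q
    simp only [absC]
    rw [Function.update_of_ne (by simp)]
  · funext q
    simp only [absC]
    by_cases h : q = k
    · subst h
      have e2 := Function.update_self q (((absC c).cons q ++ [v]).drop (((absC c).cons q).length + 1 - 2 * n)) (absC c).cons
      exact (Function.update_self _ _ c.mst).trans e2.symm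
    · have e2 := Function.update_of_ne h (((absC c).cons k ++ [v]).drop (((absC c).cons k).length + 1 - 2 * n)) (absC c).cons
      exact (Function.update_of_ne (by simpa using h) _ c.mst).trans e2.symm
  · simp only [absC]
    rw [loc_update]
    simp only [Option.map_some, foldLS_snoc]
    rfl

theorem astep_of_estep {n a : ℕ} [NeZero n] (v0 : ℕ)
    (c c' : Cfg (LProc n a) LOp (ℕ ⊕ Fin n) (LMem n)) (e)
    (h : EStep (theImpl n a v0) c e c') : AStep v0 (absC c) e (absC c') := by
  cases e with
  | inv p op =>
    obtain ⟨h1, rfl⟩ := h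
    have := AStep.inv (v0 := v0) (x := absC c) p op (by simp [absC, h1])
    convert this using 1
    apply ASt.ext' <;> try rfl
    simp only [absC]
    rw [loc_update]; rfl
  | ret p r =>
    obtain ⟨op, log, h1, h2, rfl⟩ := h
    have := AStep.ret (v0 := v0) (x := absC c) p op (foldLS n a p op log) r (by simp [absC, h1]) h2
    convert this using 1
    apply ASt.ext' <;> try rfl
    simp only [absC]
    rw [loc_update]; rfl
  | step p =>
    obtain ⟨op, log, i, o, h1, h2, hc⟩ := h
    have hl : (absC c).loc p = some (op, foldLS n a p op log) := by simp [absC, h1]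
    change nextLS n a v0 p op (foldLS n a p op log) = _ at h2
    generalize hls : foldLS n a p op log = ls at *
    have hrd : ∀ j, rdOp n j = ⟨i, o⟩ → absC c' = ⟨(absC c).reg, (absC c).cons,
        Function.update (absC c).loc p
          (some (op, updLS n ls ⟨.inr j, some ((absC c).reg j)⟩))⟩ := by
      intro j hj; cases hj
      rw [← hls]; exact absC_rdReg c c' p op log j hc
    have hrc : ∀ k, rdC n k = ⟨i, o⟩ → absC c' = ⟨(absC c).reg, (absC c).cons,
        Function.update (absC c).loc p
          (some (op, updLS n ls ⟨.inl k, (absC c).cons k⟩))⟩ := by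
      intro j hj; cases hj
      rw [← hls]; exact absC_rdCons c c' p op log j hc
    have hwr : ∀ j v, wrOp n j v = ⟨i, o⟩ → absC c' = ⟨Function.update (absC c).reg j v,
        (absC c).cons, Function.update (absC c).loc p
          (some (op, updLS n ls ⟨.inr j, (none : Option (Rec n))⟩))⟩ := by
      intro j v hj; cases hj
      rw [← hls]; exact absC_wrReg c c' p op log j v hc
    have hwc : ∀ k v, wrC n k v = ⟨i, o⟩ → absC c' = ⟨(absC c).reg,
        Function.update (absC c).cons k (((absC c).cons k ++ [v]).drop
          (((absC c).cons k).length + 1 - 2 * n)), Function.update (absC c).loc p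
          (some (op, updLS n ls ⟨.inl k, ([] : List (Fin n × Hist n))⟩))⟩ := by
      intro j v hj; cases hj
      rw [← hls]; exact absC_wrCons c c' p op log j v hc
    cases ls with
    | bad => simp [nextLS] at h2
    | qf h => simp [nextLS] at h2
    | q j h =>
      simp only [nextLS, Sum.inl.injEq] at h2
      rw [hrd j h2]
      refine AStep.rd p op _ _ hl ?_
      simp only [updLS]
      split_ifs with hj
      · exact RdStep.qn p op j h hj
      · exact RdStep.ql p op j h hj
    | a0 =>
      rcases p with p | p
      · simp only [nextLS, Sum.inl.injEq] at h2
        rw [hrd p h2]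
        exact AStep.rd _ op _ _ hl (RdStep.a0 p op)
      · simp [nextLS] at h2
    | a1 s h =>
      rcases p with p | p
      · simp only [nextLS, Sum.inl.injEq] at h2
        rw [hwr _ _ h2]
        exact AStep.a1 p op _ _ hl
      · simp [nextLS] at h2
    | c1 r s j h =>
      rcases p with p | p
      · simp only [nextLS, Sum.inl.injEq] at h2
        rw [hrd j h2]
        refine AStep.rd _ op _ _ hl ?_
        simp only [updLS]
        split_ifs with hj
        · exact RdStep.c1n p op r s j h hj
        · exact RdStep.c1l p op r s j h hj
      · simp [nextLS] at h2
    | c2 r s j h b =>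
      rcases p with p | p
      · simp only [nextLS, Sum.inl.injEq] at h2
        rw [hrd j h2]
        refine AStep.rd _ op _ _ hl ?_
        simp only [updLS]
        split_ifs with hj
        · exact RdStep.c2n p op r s j h b hj
        · exact RdStep.c2l p op r s j h b hj
      · simp [nextLS] at h2
    | w r s h =>
      rcases p with p | p
      · simp only [nextLS, Sum.inl.injEq] at h2
        rw [hwc _ _ h2]
        exact AStep.w p op r s h hl
      · simp [nextLS] at h2
    | d r s k =>
      rcases p with p | p
      · simp only [nextLS, Sum.inl.injEq] at h2
        rw [hrc _ h2]
        exact AStep.rd _ op _ _ hl (RdStep.d p op r s k)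
      · simp [nextLS] at h2
    | hw r s h =>
      rcases p with p | p
      · simp only [nextLS, Sum.inl.injEq] at h2
        rw [hwr _ _ h2]
        have := AStep.hw (v0 := v0) p op r s h hl
        cases r <;> exact this
      · simp [nextLS] at h2
    | fin s h => rcases p with p | p <;> simp [nextLS] at h2

end Shared

namespace Shared

/-! ### Invariants -/

section Inv
variable {n a : ℕ}

def Dec (x : ASt n a) (h : Hist n) : Prop :=
  h = [] ∨ ∃ y rest, x.cons h.length = y :: rest ∧ y.2 = h

def mh (x : ASt n a) : ℕ := Finset.univ.sup fun p => (x.reg p).h.length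

def Annd (opOf : Fin n → ℕ → LOp) (x : ASt n a) (e : Entry n) : Prop :=
  1 ≤ e.2.1 ∧ e.2.1 ≤ (x.reg e.1).s ∧ e.2.2 = opOf e.1 e.2.1

def OkB (opOf : Fin n → ℕ → LOp) (x : ASt n a) (h : Hist n) (b : List (Entry n)) : Prop :=
  Dec x h ∧ h.length ≤ mh x ∧ b.Nodup ∧ ∀ e ∈ b, e ∉ h.flatten ∧ Annd opOf x e

def Ok (opOf : Fin n → ℕ → LOp) (x : ASt n a) (h : Hist n) : Prop :=
  ∃ h' b, h = h' ++ [b] ∧ OkB opOf x h' b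

def Ext (x x' : ASt n a) : Prop :=
  (∀ k, x.cons k <+: x'.cons k) ∧
  ∀ p, (x.reg p).h.length ≤ (x'.reg p).h.length ∧ (x.reg p).s ≤ (x'.reg p).s

theorem Ext.refl' (x x' : ASt n a) (h1 : x'.reg = x.reg) (h2 : x'.cons = x.cons) : Ext x x' := by
  constructor
  · intro k; rw [h2]
  · intro p; rw [h1]; simp

theorem Ext.rfl' (x : ASt n a) : Ext x x := Ext.refl' x x rfl rfl

theorem Ext.trans {x y z : ASt n a} (h1 : Ext x y) (h2 : Ext y z) : Ext x z :=
  ⟨fun k => (h1.1 k).trans (h2.1 k), fun p => ⟨(h1.2 p).1.trans (h2.2 p).1,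
    (h1.2 p).2.trans (h2.2 p).2⟩⟩

theorem le_mh (x : ASt n a) (p : Fin n) : (x.reg p).h.length ≤ mh x :=
  Finset.le_sup (f := fun p => (x.reg p).h.length) (Finset.mem_univ p)

theorem exists_mh [NeZero n] (x : ASt n a) : ∃ p, (x.reg p).h.length = mh x := by
  obtain ⟨p, _, hp⟩ := Finset.exists_mem_eq_sup (Finset.univ : Finset (Fin n))
    ⟨0, Finset.mem_univ _⟩ (fun p => (x.reg p).h.length)
  exact ⟨p, hp.symm⟩

theorem Ext.mh_le {x x' : ASt n a} (h : Ext x x') : mh x ≤ mh x' :=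
  Finset.sup_mono_fun fun p _ => (h.2 p).1

theorem Ext.dec {x x' : ASt n a} (h : Ext x x') {g : Hist n} (hg : Dec x g) : Dec x' g := by
  rcases hg with rfl | ⟨y, rest, h1, h2⟩
  · exact Or.inl rfl
  · obtain ⟨l, hl⟩ := h.1 g.length
    exact Or.inr ⟨y, rest ++ l, by rw [← hl, h1]; rfl, h2⟩

theorem Ext.annd {opOf : Fin n → ℕ → LOp} {x x' : ASt n a} (h : Ext x x') {e}
    (he : Annd opOf x e) : Annd opOf x' e :=
  ⟨he.1, he.2.1.trans (h.2 _).2, he.2.2⟩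

theorem Ext.okB {opOf : Fin n → ℕ → LOp} {x x' : ASt n a} (h : Ext x x') {g b}
    (he : OkB opOf x g b) : OkB opOf x' g b :=
  ⟨h.dec he.1, he.2.1.trans h.mh_le, he.2.2.1, fun e h' =>
    ⟨(he.2.2.2 e h').1, h.annd (he.2.2.2 e h').2⟩⟩

theorem Ext.ok {opOf : Fin n → ℕ → LOp} {x x' : ASt n a} (h : Ext x x') {g}
    (he : Ok opOf x g) : Ok opOf x' g := by
  obtain ⟨h', b, h1, h2⟩ := he
  exact ⟨h', b, h1, h.okB h2⟩

def Post (N : Fin n → ℕ) (opOf : Fin n → ℕ → LOp) (x : ASt n a) (p : Fin n) (op : LOp)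
    (s : ℕ) : Prop :=
  op ≠ .audit ∧ (x.reg p).s = s ∧ (x.reg p).o = op ∧ s = N p ∧ 1 ≤ s ∧ opOf p s = op

def LInv (N : Fin n → ℕ) (opOf : Fin n → ℕ → LOp) (x : ASt n a) :
    LProc n a → LOp → LS n → Prop
  | .inr _, op, .q _ h => op = .audit ∧ Dec x h ∧ h.length ≤ mh x
  | .inr _, op, .qf h => op = .audit ∧ Dec x h ∧ h.length ≤ mh x
  | .inl p, op, .q _ h => op = .audit ∧ Dec x h ∧ h.length ≤ mh x ∧ (x.reg p).s = N p
  | .inl p, op, .qf h => op = .audit ∧ Dec x h ∧ h.length ≤ mh x ∧ (x.reg p).s = N p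
  | .inl p, op, .a0 => op ≠ .audit ∧ (x.reg p).s + 1 = N p ∧ opOf p (N p) = op
  | .inl p, op, .a1 s h => op ≠ .audit ∧ (x.reg p).s = s ∧ (x.reg p).h = h ∧ s + 1 = N p ∧
      opOf p (N p) = op
  | .inl p, op, .c1 _ s j h => Post N opOf x p op s ∧ Dec x h ∧ h.length ≤ mh x ∧
      (p < j → (x.reg p).h.length ≤ h.length)
  | .inl p, op, .c2 _ s _ h b => Post N opOf x p op s ∧ OkB opOf x h b ∧
      (x.reg p).h.length ≤ h.length
  | .inl p, op, .w _ s h => Post N opOf x p op s ∧ Ok opOf x h ∧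
      (x.reg p).h.length < h.length
  | .inl p, op, .d _ s k => Post N opOf x p op s ∧ x.cons k ≠ [] ∧ (x.reg p).h.length < k
  | .inl p, op, .hw _ s h => Post N opOf x p op s ∧ Dec x h ∧ (x.reg p).h.length < h.length
  | .inl p, op, .fin s h => Post N opOf x p op s ∧ Dec x h ∧ h.length ≤ mh x
  | _, _, _ => False

theorem Post.frame {N N' : Fin n → ℕ} {opOf : Fin n → ℕ → LOp} {x x' : ASt n a} {p op s}
    (h : Post N opOf x p op s) (h1 : x'.reg p = x.reg p) (h2 : N' p = N p) :
    Post N' opOf x' p op s := by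
  simpa [Post, h1, h2] using h

theorem LInv.frame {N N' : Fin n → ℕ} {opOf : Fin n → ℕ → LOp} {x x' : ASt n a} {q op ls}
    (h : LInv N opOf x q op ls) (he : Ext x x')
    (hq : ∀ p, q = .inl p → x'.reg p = x.reg p ∧ N' p = N p) : LInv N' opOf x' q op ls := by
  have hmh := he.mh_le
  rcases q with p | i
  · obtain ⟨h1, h2⟩ := hq p rfl
    cases ls <;> simp only [LInv] at h ⊢
    case q j g => exact ⟨h.1, he.dec h.2.1, by omega, by rw [h1, h2]; exact h.2.2.2⟩
    case qf g => exact ⟨h.1, he.dec h.2.1, by omega, by rw [h1, h2]; exact h.2.2.2⟩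
    case a0 => rw [h1, h2]; exact h
    case a1 => rw [h1, h2]; exact h
    case c1 => rw [h1]; exact ⟨h.1.frame h1 h2, he.dec h.2.1, by omega, h.2.2.2⟩
    case c2 => rw [h1]; exact ⟨h.1.frame h1 h2, he.okB h.2.1, h.2.2⟩
    case w => rw [h1]; exact ⟨h.1.frame h1 h2, he.ok h.2.1, h.2.2⟩
    case d r s k =>
      rw [h1]; refine ⟨h.1.frame h1 h2, ?_, h.2.2⟩
      intro h0
      have := he.1 k
      rw [h0] at this
      exact h.2.1 (List.prefix_nil.mp this)
    case hw => rw [h1]; exact ⟨h.1.frame h1 h2, he.dec h.2.1, h.2.2⟩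
    case fin => exact ⟨h.1.frame h1 h2, he.dec h.2.1, by omega⟩
  · cases ls <;> simp only [LInv] at h ⊢
    case q j g => exact ⟨h.1, he.dec h.2.1, by omega⟩
    case qf g => exact ⟨h.1, he.dec h.2.1, by omega⟩

def annSt : LS n → Option ℕ
  | .c1 _ s _ _ => some s
  | .c2 _ s _ _ _ => some s
  | .w _ s _ => some s
  | .d _ s _ => some s
  | .hw _ s _ => some s
  | .fin s _ => some s
  | _ => none

theorem LInv.post {N : Fin n → ℕ} {opOf : Fin n → ℕ → LOp} {x : ASt n a} {p op ls s}
    (h : LInv N opOf x (.inl p) op ls) (hs : annSt ls = some s) : Post N opOf x p op s := by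
  cases ls <;> simp [annSt] at hs <;> subst hs <;> exact h.1

def Busy (k : ℕ) : Option (LOp × LS n) → Prop
  | some (_, .d _ _ k') => k' = k
  | some (_, .hw _ _ h) => h.length = k
  | _ => False

def Seen (e : Entry n) (b : ℕ) : LS n → Prop
  | .c2 _ _ j h bt => b + 1 ≤ h.length → e.1 < j → e ∈ h.flatten ∨ e ∈ bt
  | .w _ _ h => b + 2 ≤ h.length → e ∈ h.flatten
  | _ => True

def Own (x : ASt n a) (e : Entry n) (b : ℕ) (q0 : Fin n) : LS n → Prop
  | .c1 true _ j h => q0 < j → b ≤ h.length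
  | .c2 true _ _ h _ => b ≤ h.length
  | .w true _ h => b + 1 ≤ h.length
  | .d true _ k => b + 1 ≤ k
  | .hw true _ h => b + 1 ≤ h.length
  | .c1 false _ _ _ => b + 1 ≤ (x.reg e.1).h.length
  | .c2 false _ _ _ _ => b + 1 ≤ (x.reg e.1).h.length
  | .w false _ _ => b + 1 ≤ (x.reg e.1).h.length
  | .d false _ k => b + 2 ≤ k
  | .hw false _ h => b + 2 ≤ h.length
  | .fin _ h => e ∈ h.flatten
  | _ => True

def IncP (x : ASt n a) (e : Entry n) (b : ℕ) (q0 : Fin n) : Prop :=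
  b ≤ (x.reg q0).h.length ∧ (∀ k y, y ∈ x.cons k → b + 2 ≤ k → e ∈ y.2.flatten) ∧
  ∀ q op ls, x.loc (.inl q) = some (op, ls) → Seen e b ls

structure Inv (N : Fin n → ℕ) (opOf : Fin n → ℕ → LOp) (x : ASt n a) : Prop where
  locs : ∀ q op ls, x.loc q = some (op, ls) → LInv N opOf x q op ls
  idle : ∀ p, x.loc (.inl p) = none → (x.reg p).s = N p
  g0 : ∀ p, 1 ≤ (x.reg p).s → (x.reg p).o = opOf p (x.reg p).s
  g1 : ∀ k y, y ∈ x.cons k → y.2.length = k ∧ Ok opOf x y.2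
  g2 : ∀ p, Dec x (x.reg p).h
  g3 : ∀ k, ((x.cons k).map Prod.fst).Nodup
  g4 : ∀ k y, y ∈ x.cons k → k ≤ (x.reg y.1).h.length ∨ Busy k (x.loc (.inl y.1))
  inc : ∀ p op ls s, x.loc (.inl p) = some (op, ls) → annSt ls = some s →
    ∃ b q0, IncP x (p, s, op) b q0 ∧ Own x (p, s, op) b q0 ls

theorem IncP.step {x x' : ASt n a} {e b q0} (h : IncP x e b q0) (z : LProc n a)
    (v : Option (LOp × LS n)) (hloc : x'.loc = Function.update x.loc z v) (hext : Ext x x')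
    (hc : ∀ k y, y ∈ x'.cons k → y ∈ x.cons k ∨ (b + 2 ≤ k → e ∈ y.2.flatten))
    (hseen : ∀ op ls, v = some (op, ls) → Seen e b ls) : IncP x' e b q0 := by
  refine ⟨h.1.trans (hext.2 q0).1, ?_, ?_⟩
  · intro k y hy hk
    rcases hc k y hy with h1 | h1
    · exact h.2.1 k y h1 hk
    · exact h1 hk
  · intro q op ls hq
    rw [hloc] at hq
    by_cases hz : Sum.inl q = z
    · subst hz
      rw [Function.update_self] at hq
      exact hseen op ls hq
    · rw [Function.update_of_ne hz] at hq
      exact h.2.2 q op ls hq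

theorem Own.frame {x x' : ASt n a} {e b q0 ls} (h : Own x e b q0 ls)
    (hr : x'.reg e.1 = x.reg e.1) : Own x' e b q0 ls := by
  cases ls <;> try exact h
  all_goals rename_i r _ _ <;> try cases r
  all_goals simp only [Own] at h ⊢
  all_goals (try rw [hr]); exact h

theorem Inv.step {N N' : Fin n → ℕ} {opOf : Fin n → ℕ → LOp} {x x' : ASt n a}
    (hx : Inv N opOf x) (z : LProc n a)
    (v : Option (LOp × LS n)) (hloc : x'.loc = Function.update x.loc z v) (hext : Ext x x')
    (hreg : ∀ p, z ≠ .inl p → x'.reg p = x.reg p ∧ N' p = N p)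
    (hnew : ∀ op ls, v = some (op, ls) → LInv N' opOf x' z op ls)
    (hidle : ∀ p, z = .inl p → v = none → (x'.reg p).s = N' p)
    (h0 : ∀ p, z = .inl p → 1 ≤ (x'.reg p).s → (x'.reg p).o = opOf p (x'.reg p).s)
    (h1 : ∀ k y, y ∈ x'.cons k → y ∈ x.cons k ∨ (y.2.length = k ∧ Ok opOf x' y.2 ∧
      ∃ op r s, x.loc z = some (op, .w r s y.2)))
    (h2 : ∀ p, z = .inl p → Dec x' (x'.reg p).h)
    (h3 : ∀ k, ((x'.cons k).map Prod.fst).Nodup)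
    (h4 : ∀ k y, y ∈ x'.cons k → (z = .inl y.1 → k ≤ (x'.reg y.1).h.length ∨ Busy k v) ∧
      (z ≠ .inl y.1 → y ∈ x.cons k))
    (hseen : ∀ e b, Post N opOf x e.1 e.2.2 e.2.1 →
      (∀ op ls, x.loc z = some (op, ls) → Seen e b ls) → ∀ op ls, v = some (op, ls) → Seen e b ls)
    (hown : ∀ p op ls s, z = .inl p → v = some (op, ls) → annSt ls = some s →
      (∃ ls0, x.loc z = some (op, ls0) ∧ annSt ls0 = some s ∧
        ∀ b q0, IncP x (p, s, op) b q0 → IncP x' (p, s, op) b q0 → Own x (p, s, op) b q0 ls0 →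
          Own x' (p, s, op) b q0 ls) ∨
      ∃ b q0, IncP x' (p, s, op) b q0 ∧ Own x' (p, s, op) b q0 ls) :
    Inv N' opOf x' := by
  have hinc : ∀ e b q0, Post N opOf x e.1 e.2.2 e.2.1 → IncP x e b q0 → (∃ i, z = .inl i) →
      IncP x' e b q0 := by
    rintro e b q0 hp hi ⟨i, rfl⟩
    refine hi.step _ v hloc hext ?_ ?_
    · intro k y hy
      rcases h1 k y hy with h | ⟨h, _, op, r, s, hl⟩
      · exact Or.inl h
      · right
        intro hk
        exact hi.2.2 i op _ hl (by omega)
    · exact hseen e b hp (fun op ls hl => hi.2.2 i op ls hl)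
  have hinc' : ∀ e b q0, (∃ i, z = .inr i) → IncP x e b q0 → IncP x' e b q0 := by
    rintro e b q0 ⟨i, rfl⟩ hi
    refine ⟨hi.1.trans (hext.2 q0).1, ?_, ?_⟩
    · intro k y hy
      exact hi.2.1 k y ((h4 k y hy).2 (by simp))
    · intro q op ls hq
      rw [hloc, Function.update_of_ne (by simp)] at hq
      exact hi.2.2 q op ls hq
  constructor
  · intro q op ls hq
    rw [hloc] at hq
    by_cases hz : q = z
    · subst hz
      rw [Function.update_self] at hq
      exact hnew op ls hq
    · rw [Function.update_of_ne hz] at hq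
      refine (hx.locs q op ls hq).frame hext ?_
      rintro p rfl
      exact hreg p (Ne.symm hz)
  · intro p hp
    rw [hloc] at hp
    by_cases hz : Sum.inl p = z
    · subst hz
      rw [Function.update_self] at hp
      exact hidle p rfl hp
    · rw [Function.update_of_ne hz] at hp
      obtain ⟨e1, e2⟩ := hreg p (Ne.symm hz)
      rw [e1, e2]
      exact hx.idle p hp
  · intro p
    by_cases hz : z = Sum.inl p
    · exact h0 p hz
    · rw [(hreg p hz).1]; exact hx.g0 p
  · intro k y hy
    rcases h1 k y hy with h | ⟨h, h', _⟩
    · exact ⟨(hx.g1 k y h).1, hext.ok (hx.g1 k y h).2⟩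
    · exact ⟨h, h'⟩
  · intro p
    by_cases hz : z = Sum.inl p
    · exact h2 p hz
    · rw [(hreg p hz).1]; exact hext.dec (hx.g2 p)
  · exact h3
  · intro k y hy
    rw [hloc]
    by_cases hz : z = Sum.inl y.1
    · rw [← hz, Function.update_self]
      exact (h4 k y hy).1 hz
    · rw [Function.update_of_ne (Ne.symm hz), (hreg _ hz).1]
      exact hx.g4 k y ((h4 k y hy).2 hz)
  · intro p op ls s hp hs
    rw [hloc] at hp
    by_cases hz : z = Sum.inl p
    · rw [← hz, Function.update_self] at hp
      rcases hown p op ls s hz hp hs with ⟨ls0, e1, e2, e3⟩ | h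
      · rw [hz] at e1
        obtain ⟨b, q0, i1, i2⟩ := hx.inc p op ls0 s e1 e2
        have hi := hinc (p, s, op) b q0 ((hx.locs _ _ _ e1).post e2) i1 ⟨p, hz⟩
        exact ⟨b, q0, hi, e3 b q0 i1 hi i2⟩
      · exact h
    · rw [Function.update_of_ne (Ne.symm hz)] at hp
      obtain ⟨b, q0, i1, i2⟩ := hx.inc p op ls s hp hs
      refine ⟨b, q0, ?_, i2.frame (hreg p hz).1⟩
      rcases z with i | i
      · exact hinc (p, s, op) b q0 ((hx.locs _ _ _ hp).post hs) i1 ⟨i, rfl⟩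
      · exact hinc' _ b q0 ⟨i, rfl⟩ i1

end Inv
end Shared

namespace Shared

section Inv
variable {n a : ℕ}

theorem pick_left (h g : Hist n) : h.length ≤ (pick h g).length := by
  unfold pick; split_ifs <;> omega

theorem pick_right (h g : Hist n) : g.length ≤ (pick h g).length := by
  unfold pick; split_ifs <;> omega

theorem pick_dec {x : ASt n a} {h g : Hist n} (h1 : Dec x h ∧ h.length ≤ mh x)
    (h2 : Dec x g ∧ g.length ≤ mh x) : Dec x (pick h g) ∧ (pick h g).length ≤ mh x := by
  unfold pick; split_ifs
  · exact h2
  · exact h1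

theorem addE_mono {h : Hist n} {b : List (Entry n)} {e e' : Entry n} (he : e' ∈ b) :
    e' ∈ addE h b e := by
  unfold addE; split_ifs
  · exact he
  · simp [he]

theorem addE_self {h : Hist n} {b : List (Entry n)} {e : Entry n} (he : e.2.1 ≠ 0) :
    e ∈ h.flatten ∨ e ∈ addE h b e := by
  unfold addE; split_ifs with h1
  · tauto
  · simp

theorem addE_okB {opOf : Fin n → ℕ → LOp} {x : ASt n a} {h : Hist n} {b : List (Entry n)}
    {e : Entry n} (hok : OkB opOf x h b) (he : 1 ≤ e.2.1 → Annd opOf x e) :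
    OkB opOf x h (addE h b e) := by
  unfold addE; split_ifs with h1
  · exact hok
  · push Not at h1
    obtain ⟨h2, h3, h4⟩ := h1
    refine ⟨hok.1, hok.2.1, ?_, ?_⟩
    · rw [List.nodup_append]
      refine ⟨hok.2.2.1, by simp, ?_⟩
      intro c hc d hd
      simp only [List.mem_singleton] at hd
      subst hd
      rintro rfl
      exact h4 hc
    · intro c hc
      rw [List.mem_append, List.mem_singleton] at hc
      rcases hc with hc | rfl
      · exact hok.2.2.2 c hc
      · exact ⟨h3, he (by omega)⟩

theorem firstH_spec {N : Fin n → ℕ} {opOf : Fin n → ℕ → LOp} {x : ASt n a}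
    (hx : Inv N opOf x) {k : ℕ} (hk : x.cons k ≠ []) :
    (firstH (x.cons k)).length = k ∧ Dec x (firstH (x.cons k)) := by
  cases hc : x.cons k with
  | nil => exact absurd hc hk
  | cons y rest =>
    have h1 := (hx.g1 k y (by simp [hc])).1
    have : firstH (y :: rest) = y.2 := by simp [firstH]
    rw [this]
    refine ⟨h1, Or.inr ⟨y, rest, by rw [h1, hc], rfl⟩⟩

theorem Inv.stepRd {N N' : Fin n → ℕ} {opOf : Fin n → ℕ → LOp} {x : ASt n a}
    (hx : Inv N opOf x) (z : LProc n a) (v : Option (LOp × LS n))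
    (hreg : ∀ p, z ≠ .inl p → N' p = N p)
    (hnew : ∀ op ls, v = some (op, ls) → LInv N' opOf x z op ls)
    (hidle : ∀ p, z = .inl p → v = none → (x.reg p).s = N' p)
    (hb : ∀ k, Busy k (x.loc z) → Busy k v)
    (hseen : ∀ e b, Post N opOf x e.1 e.2.2 e.2.1 →
      (∀ op ls, x.loc z = some (op, ls) → Seen e b ls) → ∀ op ls, v = some (op, ls) → Seen e b ls)
    (hown : ∀ p op ls s, z = .inl p → v = some (op, ls) → annSt ls = some s →
      (∃ ls0, x.loc z = some (op, ls0) ∧ annSt ls0 = some s ∧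
        ∀ b q0, IncP x (p, s, op) b q0 → Own x (p, s, op) b q0 ls0 →
          Own x (p, s, op) b q0 ls)) :
    Inv N' opOf ⟨x.reg, x.cons, Function.update x.loc z v⟩ := by
  set x' : ASt n a := ⟨x.reg, x.cons, Function.update x.loc z v⟩ with hx'
  have hext : Ext x x' := Ext.refl' x x' rfl rfl
  refine hx.step z v rfl hext (fun p hp => ⟨rfl, hreg p hp⟩) ?_ hidle (fun p _ => hx.g0 p)
    (fun k y hy => Or.inl hy) (fun p _ => hext.dec (hx.g2 p)) hx.g3 ?_ hseen ?_
  · intro op ls hv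
    exact (hnew op ls hv).frame hext (fun p _ => ⟨rfl, rfl⟩)
  · intro k y hy
    refine ⟨fun hz => ?_, fun _ => hy⟩
    rcases hx.g4 k y hy with h | h
    · exact Or.inl h
    · rw [← hz] at h; exact Or.inr (hb k h)
  · intro p op ls s hz hv hs
    obtain ⟨ls0, h1, h2, h3⟩ := hown p op ls s hz hv hs
    exact Or.inl ⟨ls0, h1, h2, fun b q0 i1 _ o => (h3 b q0 i1 o).frame rfl⟩

theorem Inv.rdStep [NeZero n] {N : Fin n → ℕ} {opOf : Fin n → ℕ → LOp} {x : ASt n a}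
    (hx : Inv N opOf x) {z op ls ls'} (hl : x.loc z = some (op, ls))
    (h : RdStep x z op ls ls') :
    Inv N opOf ⟨x.reg, x.cons, Function.update x.loc z (some (op, ls'))⟩ := by
  have hI := hx.locs _ _ _ hl
  have hreg : ∀ j, Dec x (x.reg j).h ∧ (x.reg j).h.length ≤ mh x :=
    fun j => ⟨hx.g2 j, le_mh x j⟩
  have hann : ∀ j, 1 ≤ (x.reg j).s → Annd opOf x (j, (x.reg j).s, (x.reg j).o) :=
    fun j hj => ⟨hj, le_rfl, hx.g0 j hj⟩
  apply hx.stepRd z _ (fun _ _ => rfl)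
  · -- hnew
    rintro op' ls'' hv
    simp only [Option.some.injEq, Prod.mk.injEq] at hv
    obtain ⟨rfl, rfl⟩ := hv
    cases h with
    | qn p op j h hj =>
      rcases z with i | i
      · exact ⟨hI.1, (pick_dec ⟨hI.2.1, hI.2.2.1⟩ (hreg j)).1,
          (pick_dec ⟨hI.2.1, hI.2.2.1⟩ (hreg j)).2, hI.2.2.2⟩
      · exact ⟨hI.1, (pick_dec ⟨hI.2.1, hI.2.2⟩ (hreg j)).1,
          (pick_dec ⟨hI.2.1, hI.2.2⟩ (hreg j)).2⟩
    | ql p op j h hj =>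
      rcases z with i | i
      · exact ⟨hI.1, (pick_dec ⟨hI.2.1, hI.2.2.1⟩ (hreg j)).1,
          (pick_dec ⟨hI.2.1, hI.2.2.1⟩ (hreg j)).2, hI.2.2.2⟩
      · exact ⟨hI.1, (pick_dec ⟨hI.2.1, hI.2.2⟩ (hreg j)).1,
          (pick_dec ⟨hI.2.1, hI.2.2⟩ (hreg j)).2⟩
    | a0 p op =>
      exact ⟨hI.1, rfl, rfl, hI.2.1, hI.2.2⟩
    | c1n p op r s j h hj =>
      have := pick_dec ⟨hI.2.1, hI.2.2.1⟩ (hreg j)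
      refine ⟨hI.1, this.1, this.2, ?_⟩
      intro hp
      have e1 := pick_left h (x.reg j).h
      have e2 := pick_right h (x.reg j).h
      have e3 : p.val < j.val + 1 := hp
      rcases Nat.lt_succ_iff_lt_or_eq.mp e3 with h1 | h1
      · exact (hI.2.2.2 h1).trans e1
      · have : p = j := Fin.ext h1
        rw [this]; exact e2
    | c1l p op r s j h hj =>
      have := pick_dec ⟨hI.2.1, hI.2.2.1⟩ (hreg j)
      refine ⟨hI.1, ⟨this.1, this.2, by simp, by simp⟩, ?_⟩
      have e1 := pick_left h (x.reg j).h
      have e2 := pick_right h (x.reg j).h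
      have e3 : p.val < j.val + 1 := by have := p.2; omega
      rcases Nat.lt_succ_iff_lt_or_eq.mp e3 with h1 | h1
      · exact (hI.2.2.2 h1).trans e1
      · have : p = j := Fin.ext h1
        rw [this]; exact e2
    | c2n p op r s j h b hj =>
      exact ⟨hI.1, addE_okB hI.2.1 (hann j), hI.2.2⟩
    | c2l p op r s j h b hj =>
      refine ⟨hI.1, ⟨_, _, rfl, addE_okB hI.2.1 (hann j)⟩, ?_⟩
      have := hI.2.2
      simp only [List.length_append, List.length_singleton]
      omega
    | d p op r s k =>
      have := firstH_spec hx hI.2.1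
      refine ⟨hI.1, this.2, ?_⟩
      rw [this.1]; exact hI.2.2
  · simp
  · intro k hk
    rw [hl] at hk
    cases h <;> simp only [Busy] at hk ⊢
    rw [(firstH_spec hx hI.2.1).1]; exact hk
  · intro e b hp hs op' ls'' hv
    simp only [Option.some.injEq, Prod.mk.injEq] at hv
    obtain ⟨rfl, rfl⟩ := hv
    have hs' := hs _ _ hl
    obtain ⟨_, hp1, hp2, _, hp3, _⟩ := hp
    cases h <;> simp only [Seen] at hs' ⊢
    case c1l p r s h j hj => intro _ h0; exact absurd h0 (by simp)
    case c2n p r s j h bt hj =>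
      intro h1 h2
      have e3 : e.1.val < j.val + 1 := h2
      rcases Nat.lt_succ_iff_lt_or_eq.mp e3 with h3 | h3
      · rcases hs' h1 h3 with h4 | h4
        · exact Or.inl h4
        · exact Or.inr (addE_mono h4)
      · have : e.1 = j := Fin.ext h3
        subst this
        rw [hp1, hp2]
        exact addE_self (e := e) (by omega)
    case c2l p r s j h bt hj =>
      intro h1
      simp only [List.length_append, List.length_singleton] at h1
      simp only [List.flatten_append, List.mem_append, List.flatten_singleton]
      have e3 : e.1.val < j.val + 1 := by have := e.1.2; omega
      rcases Nat.lt_succ_iff_lt_or_eq.mp e3 with h3 | h3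
      · rcases hs' (by omega) h3 with h4 | h4
        · exact Or.inl h4
        · exact Or.inr (addE_mono h4)
      · have : e.1 = j := Fin.ext h3
        subst this
        rw [hp1, hp2]
        exact addE_self (e := e) (by omega)
  · intro p op' ls'' s hz hv hs
    simp only [Option.some.injEq, Prod.mk.injEq] at hv
    obtain ⟨rfl, rfl⟩ := hv
    refine ⟨ls, hl, ?_, ?_⟩
    · cases h <;> simp [annSt] at hs ⊢ <;> exact hs
    · intro b q0 hi ho
      cases h with
      | qn => simp [annSt] at hs
      | ql => simp [annSt] at hs
      | a0 => simp [annSt] at hs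
      | c1n p op r s j h hj =>
        cases r
        · exact ho
        · simp only [Own] at ho ⊢
          intro h0
          have e1 := pick_left h (x.reg j).h
          have e2 := pick_right h (x.reg j).h
          have e3 : q0.val < j.val + 1 := h0
          rcases Nat.lt_succ_iff_lt_or_eq.mp e3 with h1 | h1
          · exact (ho h1).trans e1
          · have : q0 = j := Fin.ext h1
            subst this; exact hi.1.trans e2
      | c1l p op r s j h hj =>
        cases r
        · exact ho
        · simp only [Own] at ho ⊢
          have e1 := pick_left h (x.reg j).h
          have e2 := pick_right h (x.reg j).h
          have e3 : q0.val < j.val + 1 := by have := q0.2; omega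
          rcases Nat.lt_succ_iff_lt_or_eq.mp e3 with h1 | h1
          · exact (ho h1).trans e1
          · have : q0 = j := Fin.ext h1
            subst this; exact hi.1.trans e2
      | c2n p op r s j h bt hj =>
        cases r <;> exact ho
      | c2l p op r s j h bt hj =>
        cases r
        · exact ho
        · simp only [Own] at ho ⊢
          simp only [List.length_append, List.length_singleton]
          omega
      | d p op r s k =>
        have := (firstH_spec hx hI.2.1).1
        cases r <;> simp only [Own] at ho ⊢ <;> rw [this] <;> exact ho

def isLL (e : Ev (LProc n a) LOp (LRes n)) (i : Fin n) : Prop :=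
  ∃ op, op ≠ LOp.audit ∧ e = .inv (.inl i) op

open Classical in
noncomputable def Nstep (N : Fin n → ℕ) (e : Ev (LProc n a) LOp (LRes n)) : Fin n → ℕ :=
  fun i => N i + if isLL e i then 1 else 0

theorem Inv.ok_len {N : Fin n → ℕ} {opOf : Fin n → ℕ → LOp} {x : ASt n a} (_hx : Inv N opOf x)
    {h : Hist n} (hk : Ok opOf x h) : h.length ≤ mh x + 1 := by
  obtain ⟨h', b, rfl, hb⟩ := hk
  have := hb.2.1
  simp only [List.length_append, List.length_singleton]
  omega

theorem Dec.mem_cons {x : ASt n a} {h : Hist n} (hd : Dec x h) (hne : 0 < h.length) :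
    ∃ y ∈ x.cons h.length, y.2 = h := by
  rcases hd with rfl | ⟨y, rest, h1, h2⟩
  · simp at hne
  · exact ⟨y, by simp [h1], h2⟩

theorem Inv.astep [NeZero n] {v0 : ℕ} {N : Fin n → ℕ} {opOf : Fin n → ℕ → LOp} {x x' : ASt n a}
    (hx : Inv N opOf x) {e} (h : AStep v0 x e x')
    (hleg : ∀ p op, e = .inv p op → LLegal n a p op)
    (hop : ∀ i op, e = .inv (.inl i) op → op ≠ .audit → opOf i (N i + 1) = op) :
    Inv (Nstep N e) opOf x' ∧ Ext x x' := by
  have hNe : (∀ p op, e ≠ .inv p op) → Nstep N e = N := by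
    intro he
    funext i
    have : ¬ isLL e i := by rintro ⟨op, _, h⟩; exact he _ _ h
    simp [Nstep, this]
  cases h with
  | inv p op hp =>
    refine ⟨?_, Ext.refl' _ _ rfl rfl⟩
    apply hx.stepRd p
    · intro i hi
      have : ¬ isLL (n := n) (a := a) (.inv p op) i := by
        rintro ⟨op', _, h⟩; cases h; exact hi rfl
      simp [Nstep, this]
    · intro op' ls hv
      simp only [Option.some.injEq, Prod.mk.injEq] at hv
      obtain ⟨rfl, rfl⟩ := hv
      have hl := hleg p op rfl
      have haud : ∀ i, ¬ isLL (n := n) (a := a) (.inv p .audit) i := by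
        rintro i ⟨op', h1, h⟩; cases h; exact h1 rfl
      have hll : ∀ i, op ≠ .audit → isLL (n := n) (a := a) (.inv (.inl i) op) i :=
        fun i h => ⟨op, h, rfl⟩
      rcases p with i | i
      · have hid := hx.idle i hp
        by_cases ho : op = .audit
        · subst ho
          refine ⟨rfl, Or.inl rfl, by simp, ?_⟩
          simp [Nstep, haud, hid]
        · have : initLS n a (.inl i) op = .a0 := by cases op <;> simp_all [initLS]
          rw [this]
          have e1 : Nstep (a := a) N (.inv (.inl i) op) i = N i + 1 := by simp [Nstep, hll i ho]
          refine ⟨ho, ?_, ?_⟩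
          · rw [e1, hid]
          · rw [e1]; exact hop i op rfl ho
      · cases op <;> simp [LLegal] at hl
        exact ⟨rfl, Or.inl rfl, by simp⟩
    · simp
    · intro k hk; rw [hp] at hk; exact hk.elim
    · intro e b _ _ op' ls hv
      simp only [Option.some.injEq, Prod.mk.injEq] at hv
      obtain ⟨rfl, rfl⟩ := hv
      rcases p with i | i <;> cases op <;> simp [initLS, Seen]
    · intro i op' ls s hz hv hs
      simp only [Option.some.injEq, Prod.mk.injEq] at hv
      obtain ⟨rfl, rfl⟩ := hv
      rcases p with i | i <;> cases op <;> simp [initLS, annSt] at hs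
  | ret p op ls r hp hn =>
    rw [hNe (by simp)]
    refine ⟨?_, Ext.refl' _ _ rfl rfl⟩
    have hI := hx.locs _ _ _ hp
    apply hx.stepRd p
    · simp
    · simp
    · rintro i rfl _
      cases ls <;> simp only [nextLS, LInv] at hn hI <;> try exact hI.elim
      all_goals try cases hn
      · exact hI.2.2.2
      · exact hI.1.2.1.trans hI.1.2.2.2.1
    · intro k hk
      rw [hp] at hk
      rcases p with i | i <;> cases ls <;> simp only [nextLS, LInv, Busy] at hn hI hk <;> cases hn
    · simp
    · simp
  | rd p op ls ls' hl h =>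
    rw [hNe (by simp)]
    exact ⟨hx.rdStep hl h, Ext.refl' _ _ rfl rfl⟩
  | a1 p op s h hl =>
    rw [hNe (by simp)]
    have hI := hx.locs _ _ _ hl
    obtain ⟨hI1, hI2, hI3, hI4, hI5⟩ := hI
    have hext : Ext x ⟨Function.update x.reg p ⟨s + 1, op, h⟩, x.cons,
        Function.update x.loc (.inl p) (some (op, .c1 true (s + 1) 0 []))⟩ := by
      refine ⟨fun k => List.prefix_rfl, fun q => ?_⟩
      by_cases hq : q = p
      · subst hq; simp [hI3, hI2]
      · simp [Function.update_of_ne hq]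
    refine ⟨?_, hext⟩
    refine hx.step (.inl p) _ rfl hext ?_ ?_ ?_ ?_ (fun k y hy => Or.inl hy) ?_ hx.g3 ?_ ?_ ?_
    · intro q hq
      have : q ≠ p := fun h => hq (by rw [h])
      simp [Function.update_of_ne this]
    · intro op' ls hv
      simp only [Option.some.injEq, Prod.mk.injEq] at hv
      obtain ⟨rfl, rfl⟩ := hv
      refine ⟨⟨hI1, by simp, by simp, hI4, by omega, ?_⟩, Or.inl rfl, by simp, ?_⟩
      · rw [hI4]; exact hI5
      · intro h0; exact absurd h0 (by simp)
    · simp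
    · intro q hq _
      cases hq
      simp only [Function.update_self]
      rw [hI4]; exact hI5.symm
    · intro q hq
      cases hq
      simp only [Function.update_self]
      rw [← hI3]; exact hext.dec (hx.g2 p)
    · intro k y hy
      refine ⟨fun hz => Or.inl ?_, fun _ => hy⟩
      cases hz
      rcases hx.g4 k y hy with h0 | h0
      · simp only [Function.update_self]; rw [← hI3]; exact h0
      · rw [hl] at h0; exact h0.elim
    · intro e b _ _ op' ls hv
      simp only [Option.some.injEq, Prod.mk.injEq] at hv
      obtain ⟨rfl, rfl⟩ := hv
      exact trivial
    · intro q op' ls s' hz hv hs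
      right
      cases hz
      simp only [Option.some.injEq, Prod.mk.injEq] at hv
      obtain ⟨rfl, rfl⟩ := hv
      obtain ⟨q0, hq0⟩ := exists_mh x
      refine ⟨mh x, q0, ⟨?_, ?_, ?_⟩, ?_⟩
      · rw [← hq0]; exact (hext.2 q0).1
      · intro k y hy hk
        have h1 := hx.g1 k y hy
        have := hx.ok_len h1.2
        omega
      · intro q op' ls hq
        by_cases hqp : q = p
        · subst hqp
          simp only [Function.update_self, Option.some.injEq, Prod.mk.injEq] at hq
          obtain ⟨rfl, rfl⟩ := hq
          exact trivial
        · dsimp only at hq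
          rw [Function.update_of_ne (show (Sum.inl q : LProc n a) ≠ .inl p by simpa using hqp)] at hq
          have hI := hx.locs _ _ _ hq
          cases ls <;> simp only [Seen]
          · intro h1; have := hI.2.1.2.1; omega
          · intro h1; have := hx.ok_len hI.2.1; omega
      · intro h0; exact absurd h0 (by simp)
  | hw p op r s h hl =>
    rw [hNe (by simp)]
    have hI := hx.locs _ _ _ hl
    obtain ⟨hI1, hI2, hI3⟩ := hI
    obtain ⟨hP1, hP2, hP3, hP4, hP5, hP6⟩ := hI1
    have hext : Ext x ⟨Function.update x.reg p ⟨s, op, h⟩, x.cons,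
        Function.update x.loc (.inl p) (some (op, afterHw r s h))⟩ := by
      refine ⟨fun k => List.prefix_rfl, fun q => ?_⟩
      by_cases hq : q = p
      · subst hq; simp [hP2]; omega
      · simp [Function.update_of_ne hq]
    refine ⟨?_, hext⟩
    refine hx.step (.inl p) _ rfl hext ?_ ?_ ?_ ?_ (fun k y hy => Or.inl hy) ?_ hx.g3 ?_ ?_ ?_
    · intro q hq
      have : q ≠ p := fun h => hq (by rw [h])
      simp [Function.update_of_ne this]
    · intro op' ls hv
      simp only [Option.some.injEq, Prod.mk.injEq] at hv
      obtain ⟨rfl, rfl⟩ := hv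
      cases r
      · refine ⟨⟨hP1, by simp, by simp, hP4, hP5, hP6⟩, hext.dec hI2, ?_⟩
        have := le_mh (a := a) ⟨Function.update x.reg p ⟨s, op, h⟩, x.cons,
          Function.update x.loc (.inl p) (some (op, afterHw false s h))⟩ p
        simpa using this
      · refine ⟨⟨hP1, by simp, by simp, hP4, hP5, hP6⟩, Or.inl rfl, by simp, ?_⟩
        intro h0; exact absurd h0 (by simp)
    · simp
    · intro q hq _
      cases hq
      simp only [Function.update_self]
      exact hP6.symm
    · intro q hq
      cases hq
      simp only [Function.update_self]
      exact hext.dec hI2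
    · intro k y hy
      refine ⟨fun hz => Or.inl ?_, fun _ => hy⟩
      cases hz
      simp only [Function.update_self]
      rcases hx.g4 k y hy with h0 | h0
      · omega
      · rw [hl] at h0; simp only [Busy] at h0; omega
    · intro e b _ _ op' ls hv
      simp only [Option.some.injEq, Prod.mk.injEq] at hv
      obtain ⟨rfl, rfl⟩ := hv
      cases r <;> exact trivial
    · intro q op' ls s' hz hv hs
      left
      cases hz
      simp only [Option.some.injEq, Prod.mk.injEq] at hv
      obtain ⟨rfl, rfl⟩ := hv
      refine ⟨_, hl, ?_, ?_⟩
      · cases r <;> exact hs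
      · intro b q0 hi _ ho
        cases r
        · simp only [Own, afterHw] at ho ⊢
          obtain ⟨y, hy, hyh⟩ := hI2.mem_cons (by omega)
          rw [← hyh]
          exact hi.2.1 _ y hy ho
        · simpa [Own, afterHw] using ho
  | w p op r s h hl =>
    rw [hNe (by simp)]
    have hI := hx.locs _ _ _ hl
    obtain ⟨hI1, hI2, hI3⟩ := hI
    have hnot : p ∉ (x.cons h.length).map Prod.fst := by
      intro hm
      obtain ⟨y, hy, rfl⟩ := List.mem_map.mp hm
      rcases hx.g4 _ y hy with h0 | h0
      · omega
      · rw [hl] at h0; exact h0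
    have hnd : ((x.cons h.length ++ [(p, h)]).map Prod.fst).Nodup := by
      rw [List.map_append, List.nodup_append]
      refine ⟨hx.g3 _, by simp, ?_⟩
      intro c hc d hd
      simp only [List.map_cons, List.map_nil, List.mem_singleton] at hd
      subst hd
      rintro rfl
      exact hnot hc
    have hlen : (x.cons h.length).length + 1 - 2 * n = 0 := by
      have := hnd.length_le_card
      simp only [List.map_append, List.length_append, List.length_map, List.map_cons,
        List.length_cons, List.map_nil, List.length_nil, Fintype.card_fin] at this
      omega
    rw [hlen, List.drop_zero]
    have hext : Ext x ⟨x.reg, Function.update x.cons h.length (x.cons h.length ++ [(p, h)]),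
        Function.update x.loc (.inl p) (some (op, .d r s h.length))⟩ := by
      refine ⟨fun k => ?_, fun q => ⟨le_rfl, le_rfl⟩⟩
      by_cases hk : k = h.length
      · subst hk; simp
      · simp [Function.update_of_ne hk]
    have hmem : ∀ k y, y ∈ Function.update x.cons h.length (x.cons h.length ++ [(p, h)]) k →
        y ∈ x.cons k ∨ (k = h.length ∧ y = (p, h)) := by
      intro k y hy
      by_cases hk : k = h.length
      · subst hk
        simp only [Function.update_self, List.mem_append, List.mem_singleton] at hy
        tauto
      · rw [Function.update_of_ne hk] at hy; exact Or.inl hy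
    refine ⟨?_, hext⟩
    refine hx.step (.inl p) _ rfl hext ?_ ?_ ?_ (fun q _ => hx.g0 q) ?_
      (fun q _ => hext.dec (hx.g2 q)) ?_ ?_ ?_ ?_
    · intro q hq
      exact ⟨rfl, rfl⟩
    · intro op' ls hv
      simp only [Option.some.injEq, Prod.mk.injEq] at hv
      obtain ⟨rfl, rfl⟩ := hv
      exact ⟨hI1.frame rfl rfl, by simp, hI3⟩
    · simp
    · intro k y hy
      rcases hmem k y hy with h0 | ⟨rfl, rfl⟩
      · exact Or.inl h0
      · exact Or.inr ⟨rfl, hext.ok hI2, op, r, s, hl⟩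
    · intro k
      by_cases hk : k = h.length
      · subst hk; simp only [Function.update_self]; exact hnd
      · simp only [Function.update_of_ne hk]; exact hx.g3 k
    · intro k y hy
      rcases hmem k y hy with h0 | ⟨rfl, rfl⟩
      · refine ⟨fun hz => ?_, fun _ => h0⟩
        cases hz
        rcases hx.g4 k y h0 with h1 | h1
        · exact Or.inl h1
        · rw [hl] at h1; exact h1.elim
      · exact ⟨fun _ => Or.inr rfl, fun h => absurd rfl h⟩
    · intro e b _ _ op' ls hv
      simp only [Option.some.injEq, Prod.mk.injEq] at hv
      obtain ⟨rfl, rfl⟩ := hv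
      exact trivial
    · intro q op' ls s' hz hv hs
      left
      cases hz
      simp only [Option.some.injEq, Prod.mk.injEq] at hv
      obtain ⟨rfl, rfl⟩ := hv
      refine ⟨_, hl, hs, ?_⟩
      intro b q0 hi _ ho
      cases r
      · simp only [Own] at ho ⊢; omega
      · exact ho

theorem Inv.init [NeZero n] (opOf : Fin n → ℕ → LOp) :
    Inv (fun _ => 0) opOf (absC (initCfg (LProc n a) LOp (ℕ ⊕ Fin n) (LMem n))) := by
  constructor
  · intro q op ls h; simp [absC, initCfg] at h
  · intro p _; rfl
  · intro p h; exact absurd h (Nat.not_succ_le_zero 0)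
  · intro k y hy; exact absurd hy (List.not_mem_nil)
  · intro p; exact Or.inl rfl
  · intro k; exact List.nodup_nil
  · intro k y hy; exact absurd hy (List.not_mem_nil)
  · intro p op ls s h; simp [absC, initCfg] at h

end Inv
end Shared

namespace Shared

/-! ### Run-level facts -/

section RunLevel
variable {n a : ℕ}

theorem dec_uniq {x : ASt n a} {h h' : Hist n} (hd : Dec x h) (hd' : Dec x h')
    (hl : h.length = h'.length) : h = h' := by
  rcases hd with rfl | ⟨y, rest, h1, h2⟩
  · exact (List.length_eq_zero_iff.mp hl.symm).symm
  · rcases hd' with rfl | ⟨y', rest', h1', h2'⟩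
    · exact List.length_eq_zero_iff.mp hl
    · rw [hl, h1'] at h1
      cases h1
      rw [← h2, ← h2']

theorem dec_snoc {N : Fin n → ℕ} {opOf : Fin n → ℕ → LOp} {x : ASt n a} (hx : Inv N opOf x)
    {h : Hist n} (hd : Dec x h) : h = [] ∨ ∃ h' b, h = h' ++ [b] ∧ OkB opOf x h' b := by
  by_cases hh : h = []
  · exact Or.inl hh
  · right
    obtain ⟨y, hy, rfl⟩ := hd.mem_cons (List.length_pos_iff.mpr hh)
    exact (hx.g1 _ _ hy).2

theorem dec_take {N : Fin n → ℕ} {opOf : Fin n → ℕ → LOp} {x : ASt n a} (hx : Inv N opOf x)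
    (m : ℕ) : ∀ {h : Hist n}, h.length = m → Dec x h → ∀ k, Dec x (h.take k) := by
  induction m with
  | zero =>
    intro h hm hd k
    obtain rfl := List.length_eq_zero_iff.mp hm
    simpa using hd
  | succ m ih =>
    intro h hm hd k
    rcases dec_snoc hx hd with rfl | ⟨h', b, rfl, hb⟩
    · simpa using hd
    · have hl : h'.length = m := by simpa using hm
      by_cases hk : k ≤ h'.length
      · rw [List.take_append_of_le_length hk]
        exact ih hl hb.1 k
      · rw [List.take_of_length_le (by simp; omega)]
        exact hd

theorem dec_good {N : Fin n → ℕ} {opOf : Fin n → ℕ → LOp} {x : ASt n a} (hx : Inv N opOf x)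
    (m : ℕ) : ∀ {h : Hist n}, h.length = m → Dec x h →
      h.flatten.Nodup ∧ ∀ e ∈ h.flatten, Annd opOf x e := by
  induction m with
  | zero =>
    intro h hm hd
    obtain rfl := List.length_eq_zero_iff.mp hm
    simp
  | succ m ih =>
    intro h hm hd
    rcases dec_snoc hx hd with rfl | ⟨h', b, rfl, hb⟩
    · simp
    · obtain ⟨i1, i2⟩ := ih (by simpa using hm) hb.1
      rw [List.flatten_append]
      simp only [List.flatten_cons, List.flatten_nil, List.append_nil]
      constructor
      · rw [List.nodup_append]
        refine ⟨i1, hb.2.2.1, ?_⟩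
        rintro e he e' he' rfl
        exact (hb.2.2.2 e he').1 he
      · intro e he
        rcases List.mem_append.mp he with he | he
        · exact i2 e he
        · exact (hb.2.2.2 e he).2

theorem inv_s_le {N : Fin n → ℕ} {opOf : Fin n → ℕ → LOp} {x : ASt n a} (hx : Inv N opOf x)
    (p : Fin n) : (x.reg p).s ≤ N p := by
  cases hl : x.loc (.inl p) with
  | none => exact (hx.idle p hl).le
  | some z =>
    obtain ⟨op, ls⟩ := z
    have := hx.locs _ _ _ hl
    cases ls <;> simp only [LInv, Post] at this <;> omega

variable [NeZero n] {v0 : ℕ}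

noncomputable abbrev xs (R : Run (theImpl n a v0)) (t : ℕ) : ASt n a := absC (R.cfg t)

theorem xs_step (R : Run (theImpl n a v0)) {t : ℕ} (ht : t < R.len) :
    AStep v0 (xs R t) (R.ev t) (xs R (t + 1)) := astep_of_estep v0 _ _ _ (R.hstep t ht)

def isL (R : Run (theImpl n a v0)) (i : Fin n) (t : ℕ) : Prop := isLL (R.ev t) i

open Classical in
noncomputable def Nn (R : Run (theImpl n a v0)) (t : ℕ) (i : Fin n) : ℕ := Nat.count (isL R i) t

def evOp {P HRes : Type} : Ev P LOp HRes → LOp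
  | .inv _ o => o
  | _ => .audit

noncomputable def opF (R : Run (theImpl n a v0)) (i : Fin n) (s : ℕ) : LOp :=
  evOp (R.ev (Nat.nth (isL R i) (s - 1)))

noncomputable def tau (R : Run (theImpl n a v0)) (e : Entry n) : ℕ :=
  Nat.nth (isL R e.1) (e.2.1 - 1)

theorem Nn_succ (R : Run (theImpl n a v0)) (t : ℕ) : Nn R (t + 1) = Nstep (Nn R t) (R.ev t) := by
  classical
  funext i
  simp only [Nn, Nstep, Nat.count_succ, isL]
  congr

theorem inv_run (R : Run (theImpl n a v0)) (hR : LegalRun R (LLegal n a)) :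
    ∀ t, t ≤ R.len → Inv (Nn R t) (opF R) (xs R t) := by
  classical
  intro t
  induction t with
  | zero =>
    intro _
    have := Inv.init (n := n) (a := a) (opF R)
    have h0 : Nn R 0 = fun _ => 0 := by funext i; simp [Nn]
    rw [h0]
    show Inv _ _ (absC (R.cfg 0))
    rw [R.h0]; exact this
  | succ t ih =>
    intro ht
    rw [Nn_succ]
    refine ((ih (by omega)).astep (xs_step R (by omega)) ?_ ?_).1
    · intro p op he
      exact hR t p op ⟨by omega, he⟩
    · intro i op he hop
      have : isL R i t := ⟨op, hop, he⟩
      simp only [opF, Nn, Nat.add_sub_cancel]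
      rw [Nat.nth_count this, he]; rfl

theorem ext_run (R : Run (theImpl n a v0)) (hR : LegalRun R (LLegal n a)) {t t' : ℕ}
    (h : t ≤ t') : t' ≤ R.len → Ext (xs R t) (xs R t') := by
  classical
  induction t', h using Nat.le_induction with
  | base => intro _; exact Ext.rfl' _
  | succ u hu ih =>
    intro ht
    refine (ih (by omega)).trans ?_
    refine ((inv_run R hR u (by omega)).astep (xs_step R (by omega)) ?_ ?_).2
    · intro p op he
      exact hR u p op ⟨by omega, he⟩
    · intro i op he hop
      have : isL R i u := ⟨op, hop, he⟩
      simp only [opF, Nn, Nat.add_sub_cancel]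
      rw [Nat.nth_count this, he]; rfl

theorem count_find (p : ℕ → Prop) [DecidablePred p] (m t : ℕ) (h : m < Nat.count p t) :
    ∃ u, u < t ∧ p u ∧ Nat.count p u = m := by
  induction t with
  | zero => simp at h
  | succ t ih =>
    by_cases h' : m < Nat.count p t
    · obtain ⟨u, h1, h2⟩ := ih h'
      exact ⟨u, by omega, h2⟩
    · rw [Nat.count_succ] at h
      by_cases hp : p t
      · simp only [hp, if_true] at h
        exact ⟨t, by omega, hp, by omega⟩
      · simp only [hp, if_false] at h; omega

theorem tau_spec (R : Run (theImpl n a v0)) (hR : LegalRun R (LLegal n a)) {t : ℕ}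
    (ht : t ≤ R.len) {e : Entry n} (he : Annd (opF R) (xs R t) e) :
    tau R e < t ∧ Nn R (tau R e) e.1 + 1 = e.2.1 ∧ R.ev (tau R e) = .inv (.inl e.1) e.2.2 ∧
      e.2.2 ≠ .audit := by
  classical
  have h1 := inv_s_le (inv_run R hR t ht) e.1
  obtain ⟨a1, a2, a3⟩ := he
  obtain ⟨u, u1, u2, u3⟩ := count_find (isL R e.1) (e.2.1 - 1) t (by
    have : Nat.count (isL R e.1) t = Nn R t e.1 := by simp only [Nn]
    omega)
  have hu : tau R e = u := by
    simp only [tau]; rw [← u3, Nat.nth_count u2]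
  have hu' : Nat.nth (isL R e.1) (e.2.1 - 1) = u := hu
  rw [hu]
  obtain ⟨op, o1, o2⟩ := u2
  have : e.2.2 = op := by
    rw [a3]; simp only [opF]; rw [hu', o2]; rfl
  refine ⟨u1, ?_, ?_, ?_⟩
  · have : Nat.count (isL R e.1) u = Nn R u e.1 := by simp only [Nn]
    omega
  · rw [this]; exact o2
  · rw [this]; exact o1

def isQ : LS n → Prop
  | .q _ _ => True
  | .qf _ => True
  | _ => False

theorem loc_step {x x' : ASt n a} {e} (h : AStep v0 x e x') {p o ls} (hl : x.loc p = some (o, ls)) :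
    (∃ r, e = .ret p r) ∨ ((∀ op, e ≠ .inv p op) ∧ (x'.loc p = some (o, ls) ∨
      ∃ ls', x'.loc p = some (o, ls') ∧ (RdStep x p o ls ls' ∨ ¬ isQ ls))) := by
  cases h with
  | inv q op hq =>
    have : p ≠ q := by rintro rfl; rw [hl] at hq; cases hq
    right
    refine ⟨by rintro op' h; cases h; exact this rfl, Or.inl ?_⟩
    dsimp only; rw [Function.update_of_ne this]; exact hl
  | ret q op ls r hq hn =>
    by_cases this : p = q
    · subst this; exact Or.inl ⟨r, rfl⟩
    right
    refine ⟨(by rintro op' h; cases h), Or.inl ?_⟩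
    dsimp only; rw [Function.update_of_ne this]; exact hl
  | rd q op ls1 ls' hq hn =>
    right
    refine ⟨(by rintro op' h; cases h), ?_⟩
    by_cases this : p = q
    · subst this
      rw [hl] at hq; cases hq
      exact Or.inr ⟨ls', Function.update_self _ _ _, Or.inl hn⟩
    · left
      dsimp only; rw [Function.update_of_ne this]; exact hl
  | a1 q op s h hq =>
    right
    refine ⟨(by rintro op' h; cases h), ?_⟩
    by_cases this : p = .inl q
    · subst this
      rw [hl] at hq; cases hq
      exact Or.inr ⟨_, Function.update_self _ _ _, Or.inr (by simp [isQ])⟩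
    · left
      dsimp only; rw [Function.update_of_ne this]; exact hl
  | hw q op r s h hq =>
    right
    refine ⟨(by rintro op' h; cases h), ?_⟩
    by_cases this : p = .inl q
    · subst this
      rw [hl] at hq; cases hq
      exact Or.inr ⟨_, Function.update_self _ _ _, Or.inr (by simp [isQ])⟩
    · left
      dsimp only; rw [Function.update_of_ne this]; exact hl
  | w q op r s h hq =>
    right
    refine ⟨(by rintro op' h; cases h), ?_⟩
    by_cases this : p = .inl q
    · subst this
      rw [hl] at hq; cases hq
      exact Or.inr ⟨_, Function.update_self _ _ _, Or.inr (by simp [isQ])⟩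
    · left
      dsimp only; rw [Function.update_of_ne this]; exact hl

/-- progress of an audit started at state `x0` -/
def QP (x0 : ASt n a) : LS n → Prop
  | .q j h => ∀ i : Fin n, i < j → (x0.reg i).h.length ≤ h.length
  | .qf h => ∀ i : Fin n, (x0.reg i).h.length ≤ h.length
  | _ => True

theorem QP_step {x0 x : ASt n a} (hext : Ext x0 x) {p o ls ls'} (h : RdStep x p o ls ls')
    (hq : QP x0 ls) : QP x0 ls' := by
  cases h <;> try exact trivial
  case qn j g hj =>
    intro i hi
    have h1 := pick_left g (x.reg j).h
    have h2 := pick_right g (x.reg j).h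
    have hi' : i.val < j.val + 1 := hi
    by_cases hij : i = j
    · subst hij
      exact ((hext.2 i).1).trans h2
    · exact (hq i (by
        have : i.val ≠ j.val := fun h => hij (Fin.ext h)
        show i.val < j.val
        omega)).trans h1
  case ql j g hj =>
    intro i
    have h1 := pick_left g (x.reg j).h
    have h2 := pick_right g (x.reg j).h
    have hi' := i.2
    by_cases hij : i = j
    · subst hij
      exact ((hext.2 i).1).trans h2
    · exact (hq i (by
        have : i.val ≠ j.val := fun h => hij (Fin.ext h)
        show i.val < j.val
        omega)).trans h1

theorem pend (R : Run (theImpl n a v0)) (hR : LegalRun R (LLegal n a)) {t tr p o r}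
    (hi : InvAt R t p o) (hm : MatchedRet R t tr p r) (u : ℕ) (hu : t + 1 ≤ u) :
    u ≤ tr → ∃ ls, (xs R u).loc p = some (o, ls) ∧ (o = .audit → QP (xs R t) ls) ∧
      ∀ i, p = .inl i → o ≠ .audit → Nn R u i = Nn R t i + 1 := by
  classical
  have htl : tr < R.len := hm.2.1.1
  induction u, hu using Nat.le_induction with
  | base =>
    intro _
    have h := xs_step R hi.1
    have hN := Nn_succ R t
    rw [hi.2] at h hN
    generalize hx' : xs R (t+1) = x' at h
    cases h with
    | inv _ _ hq =>
      refine ⟨_, Function.update_self _ _ _, ?_, ?_⟩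
      · rintro rfl
        rcases p with p | p
        · intro i hi; exact absurd hi (Fin.not_lt_zero i)
        · intro i hi; exact absurd hi (Fin.not_lt_zero i)
      · rintro i rfl ho
        rw [hN]
        have : isLL (n := n) (a := a) (.inv (.inl i) o) i := ⟨o, ho, rfl⟩
        simp [Nstep, this]
  | succ u hu ih =>
    intro hut
    obtain ⟨ls, l1, l2, l3⟩ := ih (by omega)
    have hst := xs_step R (show u < R.len by omega)
    have hN := Nn_succ R u
    rcases loc_step hst l1 with ⟨r', hr'⟩ | ⟨hni, hh⟩
    · exact absurd ⟨by omega, hr'⟩ (hm.2.2 u r' (by omega) (by omega))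
    · have hNu : ∀ i, p = .inl i → o ≠ .audit → Nn R (u+1) i = Nn R t i + 1 := by
        rintro i rfl ho
        rw [hN, ← l3 i rfl ho]
        have : ¬ isLL (R.ev u) i := by
          rintro ⟨op, _, h⟩; exact hni op h
        simp [Nstep, this]
      rcases hh with h | ⟨ls', h, hd⟩
      · exact ⟨ls, h, l2, hNu⟩
      · refine ⟨ls', h, ?_, hNu⟩
        intro ho
        rcases hd with hd | hd
        · exact QP_step (ext_run R hR (by omega) (by omega)) hd (l2 ho)
        · exfalso
          have := (inv_run R hR u (by omega)).locs _ _ _ l1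
          subst ho
          rcases p with p | p <;> cases ls <;> simp_all [LInv, Post, isQ]

theorem matched_uniq {R : Run (theImpl n a v0)} {t p tr r tr' r'} (h : MatchedRet R t tr p r)
    (h' : MatchedRet R t tr' p r') : tr = tr' ∧ r = r' := by
  obtain ⟨a1, a2, a3⟩ := h
  obtain ⟨b1, b2, b3⟩ := h'
  rcases lt_trichotomy tr tr' with hl | hl | hl
  · exact absurd a2 (b3 _ _ a1 hl)
  · subst hl
    have := a2.2.symm.trans b2.2
    cases this; exact ⟨rfl, rfl⟩
  · exact absurd b2 (a3 _ _ b1 hl)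

structure Facts (R : Run (theImpl n a v0)) (H : Hist n) (τ : Entry n → ℕ) (lv : ℕ → ℕ) : Prop where
  mono : ∀ t t', t ≤ t' → t' ≤ R.len → lv t ≤ lv t'
  nodup : H.flatten.Nodup
  inv : ∀ e ∈ H.flatten, InvAt R (τ e) (.inl e.1) e.2.2 ∧ e.2.2 ≠ .audit
  inj : ∀ e ∈ H.flatten, ∀ e' ∈ H.flatten, τ e = τ e' → e = e'
  f2 : ∀ k (hk : k < H.length), ∀ e ∈ H[k], lv (τ e) ≤ k
  f3 : ∀ t p o tr r, InvAt R t p o → MatchedRet R t tr p r → o ≠ .audit →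
    ∃ e k, ∃ hk : k < H.length, e ∈ H[k] ∧ p = .inl e.1 ∧ o = e.2.2 ∧ τ e = t ∧ k + 1 ≤ lv tr ∧
      r = resAt n a v0 (llscSpec n a v0).init H.flatten e
  f4 : ∀ t p tr r, InvAt R t p .audit → MatchedRet R t tr p r →
    ∃ k, k ≤ H.length ∧ lv t ≤ k ∧ k ≤ lv tr ∧
      r = .aset (runE n a v0 (llscSpec n a v0).init (H.take k).flatten).2.2

theorem resAt_app (st) (l l' : List (Entry n)) (e : Entry n) (he : e ∈ l) :
    resAt n a v0 st (l ++ l') e = resAt n a v0 st l e := by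
  induction l generalizing st with
  | nil => simp at he
  | cons y l ih =>
    simp only [List.cons_append, resAt]
    split_ifs with h
    · rfl
    · exact ih _ (by
        rcases List.mem_cons.mp he with h' | h'
        · exact absurd h'.symm h
        · exact h')

theorem resAt_split (st) (l l' : List (Entry n)) (e : Entry n) (he : e ∉ l) :
    resAt n a v0 st (l ++ e :: l') e = (eStep n a v0 (runE n a v0 st l) e).2 := by
  induction l generalizing st with
  | nil => simp [resAt, runE]
  | cons y l ih =>
    simp only [List.cons_append, resAt]
    have h : y ≠ e := by rintro rfl; simp at he
    rw [if_neg h]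
    exact ih _ (by intro h; exact he (List.mem_cons_of_mem _ h))

theorem facts (R : Run (theImpl n a v0)) (hR : LegalRun R (LLegal n a)) :
    ∃ H τ lv, Facts R H τ lv := by
  classical
  obtain ⟨p0, hp0⟩ := exists_mh (xs R R.len)
  have hT := inv_run R hR R.len le_rfl
  set H : Hist n := ((xs R R.len).reg p0).h with hH
  have hDH : Dec (xs R R.len) H := hT.g2 p0
  have hgood := dec_good hT _ rfl hDH
  have hpre : ∀ t, t ≤ R.len → ∀ h : Hist n, Dec (xs R t) h → h.length ≤ mh (xs R t) →
      h = H.take h.length ∧ h.length ≤ H.length := by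
    intro t ht h hd hl
    have he := ext_run R hR ht le_rfl
    have hle := he.mh_le
    have hle' : h.length ≤ H.length := by omega
    refine ⟨dec_uniq (he.dec hd) (dec_take hT _ rfl hDH _) ?_, hle'⟩
    rw [List.length_take]; omega
  refine ⟨H, tau R, fun t => mh (xs R t), ?_, hgood.1, ?_, ?_, ?_, ?_, ?_⟩
  · intro t t' h h'
    exact (ext_run R hR h h').mh_le
  · intro e he
    have := tau_spec R hR le_rfl (hgood.2 e he)
    exact ⟨⟨this.1, this.2.2.1⟩, this.2.2.2⟩
  · intro e he e' he' h
    have h1 := tau_spec R hR le_rfl (hgood.2 e he)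
    have h2 := tau_spec R hR le_rfl (hgood.2 e' he')
    obtain ⟨i, s, o⟩ := e
    obtain ⟨i', s', o'⟩ := e'
    have h3 := h1.2.2.1
    rw [h, h2.2.2.1] at h3
    cases h3
    have h4 := h1.2.1
    have h5 := h2.2.1
    rw [h] at h4
    simp only at h4 h5
    have : s = s' := by omega
    rw [this]
  · intro k hk e he
    by_contra hlt
    push Not at hlt
    have hmem : ∀ m, k < m → e ∈ (H.take m).flatten := by
      intro m hm
      rw [List.mem_flatten]
      refine ⟨H[k], ?_, he⟩
      rw [List.mem_take_iff_getElem]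
      exact ⟨k, by omega, rfl⟩
    have heH : e ∈ H.flatten := List.mem_flatten.mpr ⟨_, List.getElem_mem hk, he⟩
    have hs := tau_spec R hR le_rfl (hgood.2 e heH)
    have hu := inv_run R hR (tau R e) hs.1.le
    obtain ⟨q, hq⟩ := exists_mh (xs R (tau R e))
    obtain ⟨hp1, hp2⟩ := hpre _ hs.1.le _ (hu.g2 q) hq.le
    have hA := (dec_good hu _ rfl (hu.g2 q)).2 e (by
      rw [hp1]; exact hmem _ (by omega))
    have h1 := inv_s_le hu e.1
    have h2 := hA.2.1
    have h3 := hs.2.1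
    omega
  · intro t p o tr r hi hm ho
    obtain ⟨ls, l1, -, l3⟩ := pend R hR hi hm tr hm.1 le_rfl
    have hlt := hm.2.1.1
    have hst := xs_step R hlt
    rw [hm.2.1.2] at hst
    have hI := inv_run R hR tr hlt.le
    have hleg := hR t p o hi
    rcases p with i | i
    · generalize hx' : xs R (tr+1) = x' at hst
      cases hst with
      | ret _ op ls' _ hl hn =>
        rw [l1] at hl; cases hl
        have hL := hI.locs _ _ _ l1
        cases ls <;> simp only [nextLS, reduceCtorEq] at hn
        case bad => simp [LInv] at hL
        case qf h => exact absurd hL.1 ho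
        case fin s h =>
          obtain ⟨b, q0, -, hown⟩ := hI.inc i o _ s l1 rfl
          simp only [Own] at hown
          obtain ⟨hP, hD, hmh⟩ := hL
          obtain ⟨hp1, hp2⟩ := hpre tr hlt.le h hD hmh
          obtain ⟨bt, hb1, hb2⟩ := List.mem_flatten.mp hown
          rw [hp1, List.mem_take_iff_getElem] at hb1
          obtain ⟨k, hk, rfl⟩ := hb1
          refine ⟨(i, s, o), k, by omega, hb2, rfl, rfl, ?_, by omega, ?_⟩
          · have hs : s - 1 = Nn R t i := by
              have := l3 i rfl ho
              have := hP.2.2.2.1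
              omega
            simp only [tau, hs, Nn]
            exact Nat.nth_count (p := isL R i) ⟨o, ho, hi.2⟩
          · have : H.flatten = h.flatten ++ (H.drop h.length).flatten := by
              rw [← List.flatten_append]
              conv_rhs => rw [hp1]
              rw [List.length_take, Nat.min_eq_left hp2, List.take_append_drop]
            rw [this, resAt_app _ _ _ _ hown]
            exact (Sum.inr.inj hn).symm
    · cases o <;> simp [LLegal] at hleg; exact absurd rfl ho
  · intro t p tr r hi hm
    obtain ⟨ls, l1, l2, -⟩ := pend R hR hi hm tr hm.1 le_rfl
    have hlt := hm.2.1.1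
    have hst := xs_step R hlt
    rw [hm.2.1.2] at hst
    have hI := inv_run R hR tr hlt.le
    have hL := hI.locs _ _ _ l1
    have hQ := l2 rfl
    generalize hx' : xs R (tr+1) = x' at hst
    have key : ∃ h, ls = .qf h ∧ Dec (xs R tr) h ∧ h.length ≤ mh (xs R tr) := by
      cases hst with
      | ret _ op ls' _ hl hn =>
        rw [l1] at hl; cases hl
        rcases p with i | i <;> cases ls <;> simp only [nextLS, reduceCtorEq] at hn <;>
          simp only [LInv, Post] at hL
        case inl.qf h => exact ⟨h, rfl, hL.2.1, hL.2.2.1⟩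
        case inr.qf h => exact ⟨h, rfl, hL.2.1, hL.2.2⟩
        case inl.fin => exact absurd rfl hL.1.1
    obtain ⟨h, rfl, hD, hmh⟩ := key
    obtain ⟨hp1, hp2⟩ := hpre tr hlt.le h hD hmh
    refine ⟨h.length, hp2, ?_, hmh, ?_⟩
    · obtain ⟨q, hq⟩ := exists_mh (xs R t)
      rw [← hq]
      exact hQ q
    · rw [← hp1]
      cases hst with
      | ret _ op ls' _ hl hn =>
        rw [l1] at hl; cases hl
        simp only [nextLS] at hn
        exact (Sum.inr.inj hn).symm

end RunLevel
end Shared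

namespace Shared

/-! ### Assembly of the linearization -/

section Asm
variable {n a : ℕ} {v0 : ℕ}

def evP {P HOp HRes : Type} : Ev P HOp HRes → P
  | .inv p _ => p
  | .step p => p
  | .ret p _ => p

/-- sequential run of the specification on operations -/
def runS (n a v0 : ℕ) (s : (llscSpec n a v0).St) (l : List (LProc n a × LOp)) :
    (llscSpec n a v0).St :=
  l.foldl (fun s w => ((llscSpec n a v0).δ s w.1 w.2).1) s

def annot (n a v0 : ℕ) : (llscSpec n a v0).St → List (LProc n a × LOp) →
    List (LProc n a × LOp × LRes n)
  | _, [] => []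
  | s, w :: l => (w.1, w.2, ((llscSpec n a v0).δ s w.1 w.2).2) ::
      annot n a v0 ((llscSpec n a v0).δ s w.1 w.2).1 l

theorem annot_cons (s) (l : List (LProc n a × LOp)) :
    SeqConsistent (llscSpec n a v0) s (annot n a v0 s l) := by
  induction l generalizing s with
  | nil => exact trivial
  | cons w l ih => exact ⟨rfl, ih _⟩

theorem annot_length (s) (l : List (LProc n a × LOp)) : (annot n a v0 s l).length = l.length := by
  induction l generalizing s with
  | nil => rfl
  | cons w l ih => simp [annot, ih]

theorem annot_get (s) (l : List (LProc n a × LOp)) (k : ℕ) (hk : k < l.length)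
    (hk' : k < (annot n a v0 s l).length) :
    (annot n a v0 s l)[k] = ((l[k]).1, (l[k]).2,
      ((llscSpec n a v0).δ (runS n a v0 s (l.take k)) (l[k]).1 (l[k]).2).2) := by
  induction l generalizing s k with
  | nil => simp at hk
  | cons w l ih =>
    cases k with
    | zero => simp [annot, runS]
    | succ k =>
      simp only [annot, List.getElem_cons_succ, List.take_succ_cons]
      rw [ih _ k (by simpa using hk)]
      rfl

abbrev Item (n : ℕ) := Entry n ⊕ ℕ

variable [NeZero n]

def iop (R : Run (theImpl n a v0)) : Item n → LProc n a × LOp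
  | .inl e => (.inl e.1, e.2.2)
  | .inr t => (evP (R.ev t), .audit)

def itm (τ : Entry n → ℕ) : Item n → ℕ
  | .inl e => τ e
  | .inr t => t

def lefts (W : List (Item n)) : List (Entry n) := W.filterMap Sum.getLeft?

theorem runS_items (R : Run (theImpl n a v0)) (s) (W : List (Item n)) :
    runS n a v0 s (W.map (iop R)) = runE n a v0 s (lefts W) := by
  induction W generalizing s with
  | nil => rfl
  | cons w W ih =>
    cases w with
    | inl e => exact ih _
    | inr t =>
      have h : ((llscSpec n a v0).δ s (evP (R.ev t)) .audit).1 = s := by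
        cases evP (R.ev t) <;> rfl
      have : runS n a v0 s ((.inr t :: W).map (iop R))
        = runS n a v0 ((llscSpec n a v0).δ s (evP (R.ev t)) .audit).1 (W.map (iop R)) := rfl
      rw [this, h, ih]; rfl

/-- completed audits -/
def CA (R : Run (theImpl n a v0)) (t : ℕ) : Prop :=
  ∃ p tr r, InvAt R t p .audit ∧ MatchedRet R t tr p r

open Classical in
noncomputable def auds (R : Run (theImpl n a v0)) (alv : ℕ → ℕ) (k : ℕ) : List ℕ :=
  (List.range R.len).filter fun t => CA R t ∧ alv t = k

theorem mem_auds (R : Run (theImpl n a v0)) (alv : ℕ → ℕ) (k t : ℕ) :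
    t ∈ auds R alv k ↔ CA R t ∧ alv t = k := by
  simp only [auds, List.mem_filter, List.mem_range, decide_eq_true_eq]
  constructor
  · exact fun h => h.2
  · intro h
    obtain ⟨p, tr, r, h1, h2⟩ := h.1
    exact ⟨h1.1, h⟩

theorem sorted_auds (R : Run (theImpl n a v0)) (alv : ℕ → ℕ) (k : ℕ) :
    (auds R alv k).Pairwise (· < ·) :=
  List.Pairwise.filter _ List.pairwise_lt_range

def batch (H : Hist n) (k : ℕ) : List (Entry n) := (([] :: H)[k]?).getD []

theorem mem_batch (H : Hist n) (k : ℕ) (e : Entry n) :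
    e ∈ batch H k ↔ ∃ j, k = j + 1 ∧ ∃ h : j < H.length, e ∈ H[j] := by
  cases k with
  | zero => simp [batch]
  | succ k =>
    simp only [batch, List.getElem?_cons_succ]
    by_cases h : k < H.length
    · rw [List.getElem?_eq_getElem h]
      simp only [Option.getD_some]
      constructor
      · intro h'; exact ⟨k, rfl, h, h'⟩
      · rintro ⟨j, hj, h1, h2⟩
        obtain rfl : k = j := by omega
        exact h2
    · rw [List.getElem?_eq_none (by omega)]
      simp only [Option.getD_none, List.not_mem_nil, false_iff]
      rintro ⟨j, hj, h1, h2⟩; omega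

noncomputable def Wk (R : Run (theImpl n a v0)) (H : Hist n) (alv : ℕ → ℕ) : ℕ → List (Item n)
  | 0 => []
  | k + 1 => Wk R H alv k ++ ((batch H k).map Sum.inl ++ (auds R alv k).map Sum.inr)

theorem lefts_append (A B : List (Item n)) : lefts (A ++ B) = lefts A ++ lefts B := by
  simp [lefts]

theorem lefts_inl (l : List (Entry n)) : lefts (l.map Sum.inl) = l := by
  induction l with
  | nil => rfl
  | cons e l ih =>
    have : lefts ((e :: l).map Sum.inl) = e :: lefts (l.map Sum.inl) := rfl
    rw [this, ih]

theorem lefts_inr (l : List ℕ) : lefts (n := n) (l.map Sum.inr) = [] := by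
  induction l with
  | nil => rfl
  | cons e l ih => exact ih

theorem lefts_Wk (R : Run (theImpl n a v0)) (H : Hist n) (alv : ℕ → ℕ) (k : ℕ) :
    lefts (Wk R H alv k) = ((([] :: H) : Hist n).take k).flatten := by
  induction k with
  | zero => rfl
  | succ k ih =>
    simp only [Wk, lefts_append, lefts_inl, lefts_inr, ih, List.append_nil]
    rw [List.take_add_one, List.flatten_append]
    congr 1
    unfold batch
    cases (([] :: H)[k]?) <;> simp

theorem Wk_pre (R : Run (theImpl n a v0)) (H : Hist n) (alv : ℕ → ℕ) {k m : ℕ} (h : k ≤ m) :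
    Wk R H alv k <+: Wk R H alv m := by
  induction m, h using Nat.le_induction with
  | base => exact List.prefix_rfl
  | succ m _ ih => exact ih.trans (List.prefix_append _ _)

/-- item `w` is placed at level `k` -/
def At (R : Run (theImpl n a v0)) (H : Hist n) (alv : ℕ → ℕ) (k : ℕ) (w : Item n) : Prop :=
  (∃ e ∈ batch H k, w = .inl e) ∨ (∃ t ∈ auds R alv k, w = .inr t)

theorem mem_Wk (R : Run (theImpl n a v0)) (H : Hist n) (alv : ℕ → ℕ) (m : ℕ) (w : Item n) :
    w ∈ Wk R H alv m ↔ ∃ k < m, At R H alv k w := by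
  induction m with
  | zero => simp [Wk]
  | succ m ih =>
    simp only [Wk, List.mem_append, ih, List.mem_map]
    constructor
    · rintro (⟨k, hk, h⟩ | ⟨e, he, rfl⟩ | ⟨t, ht, rfl⟩)
      · exact ⟨k, by omega, h⟩
      · exact ⟨m, by omega, Or.inl ⟨e, he, rfl⟩⟩
      · exact ⟨m, by omega, Or.inr ⟨t, ht, rfl⟩⟩
    · rintro ⟨k, hk, h⟩
      by_cases hkm : k < m
      · exact Or.inl ⟨k, hkm, h⟩
      · obtain rfl : k = m := by omega
        rcases h with ⟨e, he, rfl⟩ | ⟨t, ht, rfl⟩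
        · exact Or.inr (Or.inl ⟨e, he, rfl⟩)
        · exact Or.inr (Or.inr ⟨t, ht, rfl⟩)

theorem batch_uniq {H : Hist n} (hH : H.flatten.Nodup) {j k : ℕ} {e : Entry n}
    (h1 : e ∈ batch H j) (h2 : e ∈ batch H k) : j = k := by
  obtain ⟨j, rfl, hj, h1⟩ := (mem_batch _ _ _).mp h1
  obtain ⟨k, rfl, hk, h2⟩ := (mem_batch _ _ _).mp h2
  rw [List.nodup_flatten] at hH
  have := List.pairwise_iff_getElem.mp hH.2
  rcases lt_trichotomy j k with h | h | h
  · exact absurd h2 (fun h' => this j k hj hk h h1 h')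
  · rw [h]
  · exact absurd h1 (fun h' => this k j hk hj h h2 h')

theorem isLin_of_facts (R : Run (theImpl n a v0)) (H : Hist n) (τ : Entry n → ℕ) (lv : ℕ → ℕ)
    (F : Facts R H τ lv) : IsLin (llscSpec n a v0) R := by
  classical
  have hex : ∀ t, ∃ k, ∀ p tr r, InvAt R t p .audit → MatchedRet R t tr p r →
      k ≤ H.length ∧ lv t ≤ k ∧ k ≤ lv tr ∧
      r = .aset (runE n a v0 (llscSpec n a v0).init (H.take k).flatten).2.2 := by
    intro t
    by_cases hc : CA R t
    · obtain ⟨p, tr, r, h1, h2⟩ := hc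
      obtain ⟨k, hk⟩ := F.f4 t p tr r h1 h2
      refine ⟨k, fun p' tr' r' h1' h2' => ?_⟩
      have : p = p' := by
        have := h1.2.symm.trans h1'.2
        cases this; rfl
      subst this
      obtain ⟨rfl, rfl⟩ := matched_uniq h2 h2'
      exact hk
    · exact ⟨0, fun p tr r h1 h2 => absurd ⟨p, tr, r, h1, h2⟩ hc⟩
  choose alv halv using hex
  set W := Wk R H alv (H.length + 1) with hW
  have hflat : ∀ k e, e ∈ batch H k → e ∈ H.flatten := by
    intro k e he
    obtain ⟨j, _, hj, h⟩ := (mem_batch _ _ _).mp he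
    exact List.mem_flatten.mpr ⟨_, List.getElem_mem hj, h⟩
  have hinvW : ∀ k w, At R H alv k w → InvAt R (itm τ w) (iop R w).1 (iop R w).2 := by
    rintro k w (⟨e, he, rfl⟩ | ⟨t, ht, rfl⟩)
    · exact (F.inv e (hflat k e he)).1
    · obtain ⟨⟨p, tr, r, h1, h2⟩, _⟩ := (mem_auds _ _ _ _).mp ht
      have : evP (R.ev t) = p := by rw [h1.2]; rfl
      simp only [iop, itm, this]
      exact h1
  have hlo : ∀ k w, At R H alv k w → lv (itm τ w) ≤ k := by
    rintro k w (⟨e, he, rfl⟩ | ⟨t, ht, rfl⟩)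
    · obtain ⟨j, rfl, hj, h⟩ := (mem_batch _ _ _).mp he
      have := F.f2 j hj e h
      simp only [itm]; omega
    · obtain ⟨⟨p, tr, r, h1, h2⟩, rfl⟩ := (mem_auds _ _ _ _).mp ht
      exact (halv t p tr r h1 h2).2.1
  have hhi : ∀ k w, At R H alv k w → ∀ tr r, MatchedRet R (itm τ w) tr (iop R w).1 r →
      k ≤ lv tr := by
    intro k w hw tr r hm
    have hI := hinvW k w hw
    rcases hw with ⟨e, he, rfl⟩ | ⟨t, ht, rfl⟩
    · have he' := hflat k e he
      obtain ⟨e2, k2, hk2, g1, g2, g3, g4, g5, g6⟩ := F.f3 _ _ _ _ _ hI hm (F.inv e he').2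
      have hb2 : e2 ∈ batch H (k2 + 1) := (mem_batch _ _ _).mpr ⟨k2, rfl, hk2, g1⟩
      have : e2 = e := F.inj e2 (hflat _ _ hb2) e he' g4
      subst this
      rw [batch_uniq F.nodup he hb2]; exact g5
    · obtain ⟨_, rfl⟩ := (mem_auds _ _ _ _).mp ht
      exact (halv t _ tr r hI hm).2.2.1
  let Q : Item n → Item n → Prop := fun x y => itm τ x ≠ itm τ y ∧
    ∀ tr r, MatchedRet R (itm τ y) tr (iop R y).1 r → ¬ tr < itm τ x
  have hQaud : ∀ e k t j, e ∈ batch H k → t ∈ auds R alv j → τ e ≠ t := by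
    rintro e k t j he ht rfl
    obtain ⟨h1, h2⟩ := F.inv e (hflat k e he)
    obtain ⟨⟨p, tr, r, h3, h4⟩, rfl⟩ := (mem_auds _ _ _ _).mp ht
    have := h1.2.symm.trans h3.2
    injection this with _ h5
    exact h2 h5
  have hQlt : ∀ j k x y, j < k → At R H alv j x → At R H alv k y → Q x y := by
    intro j k x y hjk hx hy
    constructor
    · rcases hx with ⟨e, he, rfl⟩ | ⟨t, ht, rfl⟩ <;> rcases hy with ⟨e', he', rfl⟩ | ⟨t', ht', rfl⟩
      · intro h
        have := F.inj e (hflat _ _ he) e' (hflat _ _ he') h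
        subst this
        have := batch_uniq F.nodup he he'
        omega
      · exact hQaud e _ t' _ he ht'
      · exact (hQaud e' _ t _ he' ht).symm
      · intro h
        simp only [itm] at h
        subst h
        have h1 := ((mem_auds _ _ _ _).mp ht).2
        have h2 := ((mem_auds _ _ _ _).mp ht').2
        omega
    · intro tr r hm hlt
      have h1 := hlo j x hx
      have h2 := hhi k y hy tr r hm
      have h3 := F.mono tr (itm τ x) hlt.le (hinvW j x hx).1.le
      omega
  have hpw : ∀ m, (Wk R H alv m).Pairwise Q := by
    intro m
    induction m with
    | zero => exact List.Pairwise.nil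
    | succ m ih =>
      simp only [Wk]
      rw [List.pairwise_append]
      refine ⟨ih, ?_, ?_⟩
      · have hbatch : ∀ e ∈ batch H m, lv (τ e) < m := by
          intro e he
          obtain ⟨j, rfl, hj, h⟩ := (mem_batch _ _ _).mp he
          have := F.f2 j hj e h
          omega
        have hsame : ∀ e ∈ batch H m, ∀ y, At R H alv m y →
            ∀ tr r, MatchedRet R (itm τ y) tr (iop R y).1 r → ¬ tr < τ e := by
          intro e he y hy tr r hm hlt
          have h1 := hbatch e he
          have h2 := hhi m y hy tr r hm
          have h3 := F.mono tr (τ e) hlt.le (hinvW m (.inl e) (Or.inl ⟨e, he, rfl⟩)).1.le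
          omega
        rw [List.pairwise_append]
        refine ⟨?_, ?_, ?_⟩
        · rw [List.pairwise_map]
          have hnd : (batch H m).Nodup := by
            cases m with
            | zero => simp [batch]
            | succ m =>
              unfold batch
              rw [List.getElem?_cons_succ]
              by_cases h : m < H.length
              · rw [List.getElem?_eq_getElem h]
                exact (List.nodup_flatten.mp F.nodup).1 _ (List.getElem_mem h)
              · rw [List.getElem?_eq_none (by omega)]; simp
          refine List.Pairwise.imp_of_mem ?_ hnd
          intro e e' he he' hne
          refine ⟨fun h => hne (F.inj e (hflat _ _ he) e' (hflat _ _ he') h), ?_⟩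
          exact hsame e he _ (Or.inl ⟨e', he', rfl⟩)
        · rw [List.pairwise_map]
          refine List.Pairwise.imp_of_mem ?_ (sorted_auds R alv m)
          intro t t' ht ht' hlt
          refine ⟨fun h => ?_, ?_⟩
          · simp only [itm] at h; omega
          · intro tr r hm hlt'
            have := hm.1
            simp only [itm] at this hlt'
            omega
        · intro x hx y hy
          obtain ⟨e, he, rfl⟩ := List.mem_map.mp hx
          obtain ⟨t, ht, rfl⟩ := List.mem_map.mp hy
          exact ⟨hQaud e _ t _ he ht, hsame e he _ (Or.inr ⟨t, ht, rfl⟩)⟩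
      · intro x hx y hy
        obtain ⟨k, hk, hxk⟩ := (mem_Wk _ _ _ _ _).mp hx
        refine hQlt k m x y hk hxk ?_
        rcases List.mem_append.mp hy with hy | hy
        · obtain ⟨e, he, rfl⟩ := List.mem_map.mp hy
          exact Or.inl ⟨e, he, rfl⟩
        · obtain ⟨t, ht, rfl⟩ := List.mem_map.mp hy
          exact Or.inr ⟨t, ht, rfl⟩
  have hpW : W.Pairwise Q := hpw _
  have hget := List.pairwise_iff_getElem.mp hpW
  have hWl : lefts W = H.flatten := by
    rw [hW, lefts_Wk, List.take_of_length_le (by simp)]; simp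
  set L := annot n a v0 (llscSpec n a v0).init (W.map (iop R)) with hL
  have hLl : L.length = W.length := by rw [hL, annot_length, List.length_map]
  have hLg : ∀ k (h : k < L.length) (h' : k < W.length), L[k] = ((iop R W[k]).1, (iop R W[k]).2,
      ((llscSpec n a v0).δ (runE n a v0 (llscSpec n a v0).init (lefts (W.take k)))
        (iop R W[k]).1 (iop R W[k]).2).2) := by
    intro k h h'
    have := annot_get (n := n) (a := a) (v0 := v0) (llscSpec n a v0).init (W.map (iop R)) k
      (by simpa using h') h
    simp only [List.getElem_map, ← List.map_take, runS_items] at this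
    exact this
  let φ : Fin L.length → ℕ := fun k => itm τ (W[k.1]'(by rw [← hLl]; exact k.2))
  have hinj : Function.Injective φ := by
    intro k k' h
    by_contra hne
    rcases lt_or_gt_of_ne (fun h => hne (Fin.ext h) : k.1 ≠ k'.1) with hl | hl
    · exact (hget k.1 k'.1 _ _ hl).1 h
    · exact (hget k'.1 k.1 _ _ hl).1 h.symm
  have hin : ∀ k, InvAt R (φ k) (L.get k).1 (L.get k).2.1 := by
    intro k
    have hk : k.1 < W.length := by rw [← hLl]; exact k.2
    obtain ⟨j, _, hj⟩ := (mem_Wk _ _ _ _ _).mp (List.getElem_mem (l := W) hk)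
    have := hinvW j _ hj
    rw [List.get_eq_getElem, hLg k.1 k.2 hk]
    exact this
  have hspl : ∀ A w B, W = A ++ w :: B → ∃ k : Fin L.length, φ k = itm τ w ∧
      L.get k = ((iop R w).1, (iop R w).2,
      ((llscSpec n a v0).δ (runE n a v0 (llscSpec n a v0).init (lefts A))
        (iop R w).1 (iop R w).2).2) := by
    intro A w B hAB
    have hk : A.length < W.length := by rw [hAB]; simp
    have hw : W[A.length] = w := by simp [hAB]
    have ht : W.take A.length = A := by simp [hAB]
    refine ⟨⟨A.length, by rw [hLl]; exact hk⟩, ?_, ?_⟩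
    · show itm τ W[A.length] = _
      rw [hw]
    · rw [List.get_eq_getElem, hLg A.length _ hk, hw, ht]
  have hcomp : ∀ t p o tr r, InvAt R t p o → MatchedRet R t tr p r →
        ∃ k, φ k = t ∧ L.get k = (p, o, r) := by
    intro t p o tr r hi hm
    by_cases ho : o = .audit
    · subst ho
      obtain ⟨g1, g2, g3, g4⟩ := halv t p tr r hi hm
      have hta : t ∈ auds R alv (alv t) := (mem_auds _ _ _ _).mpr ⟨⟨p, tr, r, hi, hm⟩, rfl⟩
      obtain ⟨A, B, hAB⟩ := List.append_of_mem hta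
      obtain ⟨C, hC⟩ := Wk_pre R H alv (show alv t + 1 ≤ H.length + 1 by omega)
      have hWs : W = (Wk R H alv (alv t) ++ ((batch H (alv t)).map Sum.inl ++ A.map Sum.inr)) ++
          .inr t :: (B.map Sum.inr ++ C) := by
        rw [hW, ← hC]
        simp only [Wk]
        rw [hAB]
        simp
      obtain ⟨k, k1, k2⟩ := hspl _ _ _ hWs
      refine ⟨k, k1, ?_⟩
      rw [k2]
      have hp : evP (R.ev t) = p := by rw [hi.2]; rfl
      have hl : lefts (Wk R H alv (alv t) ++ ((batch H (alv t)).map Sum.inl ++ A.map Sum.inr))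
          = (H.take (alv t)).flatten := by
        have h1 := lefts_Wk R H alv (alv t + 1)
        simp only [Wk, lefts_append, lefts_inl, lefts_inr, List.take_succ_cons,
          List.flatten_cons, List.nil_append] at h1 ⊢
        exact h1
      rw [hl]
      simp only [iop, hp]
      rw [g4]
      cases p <;> rfl
    · obtain ⟨e, k, hk, g1, rfl, rfl, rfl, g5, g6⟩ := F.f3 t p o tr r hi hm ho
      have hb : e ∈ batch H (k + 1) := (mem_batch _ _ _).mpr ⟨k, rfl, hk, g1⟩
      have heW : Sum.inl e ∈ W := (mem_Wk _ _ _ _ _).mpr ⟨k + 1, by omega, Or.inl ⟨e, hb, rfl⟩⟩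
      obtain ⟨A, B, hAB⟩ := List.append_of_mem heW
      obtain ⟨k', k1, k2⟩ := hspl _ _ _ hAB
      refine ⟨k', k1, ?_⟩
      rw [k2, g6]
      have hs : H.flatten = lefts A ++ e :: lefts B := by
        rw [← hWl, hAB, lefts_append]; rfl
      have hnd := F.nodup
      rw [hs] at hnd ⊢
      rw [resAt_split]
      · rfl
      · intro h
        exact (List.nodup_append.mp hnd).2.2 e h e List.mem_cons_self rfl
  refine ⟨L, φ, annot_cons _ _, hinj, hin, hcomp, ?_, ?_⟩
  · intro k tr r hm
    obtain ⟨k', h1, h2⟩ := hcomp _ _ _ _ _ (hin k) hm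
    have := hinj h1
    subst this
    rw [h2]
  · intro k k' tr r hm hlt
    by_contra hle
    rcases lt_or_eq_of_le (not_lt.mp hle) with h | h
    · have hk : k.1 < W.length := by rw [← hLl]; exact k.2
      have hq := (hget k'.1 k.1 (by rw [← hLl]; exact k'.2) hk h).2 tr r
      rw [List.get_eq_getElem, hLg k.1 k.2 hk] at hm
      exact hq hm hlt
    · subst h
      have := hm.1
      omega

end Asm
end Shared

namespace Shared

/-- Theorem 3.  There is a wait-free, linearizable
implementation of an `n`-process auditable load-linked/store-conditional
(LL/SC) object (auditable by any number `a` of auditors) from `2n`-sliding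
registers and standard read/write registers, with `O(n)` step complexity per
LL, SC and AUDIT operation. -/
theorem auditable_llsc_from_sliding_registers :
    ∃ C : ℕ, ∀ (n a : ℕ), 0 < n → ∀ v0 : ℕ,
      ∃ (Is Ir : Type) (_ : DecidableEq Is) (_ : DecidableEq Ir)
        (Vs : Type) (Vr : Ir → Type) (vr0 : ∀ r : Ir, Vr r)
        (impl : Impl (LProc n a) LOp (LRes n) (Is ⊕ Ir)
          (Sum.elim (fun _ : Is => SlidingReg (2 * n) Vs)
                    (fun r : Ir => RWReg (Vr r) (vr0 r)))),
        -- linearizability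
        (∀ R : Run impl, LegalRun R (LLegal n a) → IsLin (llscSpec n a v0) R) ∧
        (∀ R : Run impl, LegalRun R (LLegal n a) → StepBound R (C * n)) := by
  refine ⟨12, fun n a hn v0 => ?_⟩
  haveI : NeZero n := ⟨hn.ne'⟩
  refine ⟨ℕ, Fin n, inferInstance, inferInstance, Fin n × Hist n, fun _ => Rec n,
    fun _ => Rec.z n, theImpl n a v0, fun R hR => ?_, fun R _ => stepBound_main n a v0 R⟩
  obtain ⟨H, τ, lv, F⟩ := facts R hR
  exact isLin_of_facts R H τ lv F

end Shared
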